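/- arXiv:1407.2861 — 3 statements merged into one kernel-verified Lean document; each statement's English description precedes it below -/
import Mathlib

section
/- Fix an integer n ≥ 3. There exist positive constants κ_1(n), κ_2(n) and C(n), depending only on n, such that for all 0 < ξ < 1 and all t ∈ ℝ: |ω_n(ξ,t) − φ_{n−1}(t)| ≤ C(n)·ξ²t² when |t| ≤ κ_1(n)ξ^{−1/2}; |ω_n(ξ,t) − φ_{n−1}(t)| ≤ C(n)·ξ when κ_1(n)ξ^{−1/2} < |t| ≤ κ_2(n)ξ^{−1}; and |ω_n(ξ,t) − φ_{n−1}(t)| ≤ C(n)·t^{−2} when |t| > κ_2(n)ξ^{−1}. -/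
open MeasureTheory Filter

/-- The domain `D_n(ξ,t) ⊆ ℝ^{n-1}`. -/
def Dset (n : ℕ) (ξ t : ℝ) : Set (Fin (n - 1) → ℝ) :=
  {p | (∀ i, |p i| ≤ 1) ∧ |ξ * t ^ n + ∑ i, p i * t ^ ((i : ℕ) + 1)| ≤ 1}

/-- The density function `ω_n(ξ,t)`. -/
noncomputable def omegaFn (n : ℕ) (ξ t : ℝ) : ℝ :=
  ∫ p in Dset n ξ t,
    |(n : ℝ) * ξ * t ^ (n - 1) + ∑ i : Fin (n - 1), ((i : ℕ) + 1 : ℝ) * p i * t ^ (i : ℕ)|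

/-- The domain `G_n(t) ⊆ ℝ^n`: vectors `(p_1, …, p_n)` (indexed by `i : Fin n`, where `p i`
stands for `p_{i+1}`) with `|p_i| ≤ 1` and `|∑_{k=1}^{n} p_k t^k| ≤ 1`. -/
def Gset (n : ℕ) (t : ℝ) : Set (Fin n → ℝ) :=
  {p | (∀ i, |p i| ≤ 1) ∧ |∑ i, p i * t ^ ((i : ℕ) + 1)| ≤ 1}

/-- The density function `φ_n(t)` of real algebraic numbers of degree `n`. -/
noncomputable def phiFn (n : ℕ) (t : ℝ) : ℝ :=
  ∫ p in Gset n t, |∑ i : Fin n, ((i : ℕ) + 1 : ℝ) * p i * t ^ (i : ℕ)|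


/-- box with two slab constraints -/
def Bs {m : ℕ} (u v : Fin m → ℝ) (c1 c2 e1 e2 : ℝ) : Set (Fin m → ℝ) :=
  {p | (∀ k, |p k| ≤ 2) ∧ |∑ k, u k * p k - c1| ≤ e1 ∧ |∑ k, v k * p k - c2| ≤ e2}

lemma Bs_meas {m : ℕ} (u v : Fin m → ℝ) (c1 c2 e1 e2 : ℝ) :
    MeasurableSet (Bs u v c1 c2 e1 e2) := by
  have h : IsClosed (Bs u v c1 c2 e1 e2) := by
    unfold Bs
    simp only [Set.ofPred_and, Set.ofPred_forall]
    refine IsClosed.inter (isClosed_iInter fun k => ?_) (IsClosed.inter ?_ ?_)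
    all_goals exact isClosed_le (by fun_prop) (by fun_prop)
  exact h.measurableSet

lemma Bs_fin {m : ℕ} (u v : Fin m → ℝ) (c1 c2 e1 e2 : ℝ) :
    volume (Bs u v c1 c2 e1 e2) < ⊤ := by
  have : Bs u v c1 c2 e1 e2 ⊆ Set.Icc (fun _ => -2) (fun _ => 2) := by
    intro p hp
    exact ⟨fun k => (abs_le.1 (hp.1 k)).1, fun k => (abs_le.1 (hp.1 k)).2⟩
  refine (measure_mono this).trans_lt ?_
  rw [Real.volume_Icc_pi]
  exact ENNReal.prod_lt_top (fun _ _ => ENNReal.ofReal_lt_top)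

lemma det_aux {m : ℕ} (i j : Fin m) (hij : i ≠ j) (u v : Fin m → ℝ) :
    ∃ M : Matrix (Fin m) (Fin m) ℝ, M.det = u i * v j - u j * v i ∧
      (∀ p, M.mulVec p i = ∑ k, u k * p k) ∧ (∀ p, M.mulVec p j = ∑ k, v k * p k) ∧
      (∀ p k, k ≠ i → k ≠ j → M.mulVec p k = p k) := by
  let A : Matrix (Fin m) (Fin 2) ℝ := Matrix.of fun k l => if l = 0 then (if k = i then 1 else 0) else (if k = j then 1 else 0)
  let B : Matrix (Fin 2) (Fin m) ℝ := Matrix.of fun l k => if l = 0 then u k - (if k = i then 1 else 0) else v k - (if k = j then 1 else 0)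
  have hA : ∀ p k, (1 + A * B).mulVec p k = p k + (if k = i then ((∑ k, u k * p k) - p i) else 0)
      + (if k = j then ((∑ k, v k * p k) - p j) else 0) := by
    intro p k
    rw [Matrix.add_mulVec, ← Matrix.mulVec_mulVec, Matrix.one_mulVec]
    have h0 : B.mulVec p 0 = (∑ k, u k * p k) - p i := by
      simp [B, Matrix.mulVec, dotProduct, sub_mul, Finset.sum_sub_distrib]
    have h1 : B.mulVec p 1 = (∑ k, v k * p k) - p j := by
      simp [B, Matrix.mulVec, dotProduct, sub_mul, Finset.sum_sub_distrib]
    have h2 : ∀ q : Fin 2 → ℝ, A.mulVec q k = (if k = i then q 0 else 0) + (if k = j then q 1 else 0) := by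
      intro q
      simp [A, Matrix.mulVec, dotProduct, Fin.sum_univ_two]
    rw [Pi.add_apply, h2, h0, h1, add_assoc]
  refine ⟨1 + A * B, ?_, ?_, ?_, ?_⟩
  · rw [Matrix.det_one_add_mul_comm, Matrix.det_fin_two]
    simp [A, B, Matrix.mul_apply, hij, hij.symm]
  · intro p; rw [hA]; simp [hij]
  · intro p; rw [hA]; simp [hij.symm]
  · intro p k h1 h2; rw [hA]; simp [h1, h2]

lemma Bs_vol {m : ℕ} (i j : Fin m) (hij : i ≠ j) (u v : Fin m → ℝ) (c1 c2 e1 e2 : ℝ)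
    (h1 : 0 ≤ e1) (h2 : 0 ≤ e2) (hd : u i * v j - u j * v i ≠ 0) :
    volume.real (Bs u v c1 c2 e1 e2) ≤ 4 ^ m * (e1 * e2 / |u i * v j - u j * v i|) := by
  obtain ⟨M, hM, hi, hj, hk⟩ := det_aux i j hij u v
  let a : Fin m → ℝ := fun k => if k = i then c1 - e1 else if k = j then c2 - e2 else -2
  let b : Fin m → ℝ := fun k => if k = i then c1 + e1 else if k = j then c2 + e2 else 2
  have hsub : Bs u v c1 c2 e1 e2 ⊆ (Matrix.toLin' M) ⁻¹' (Set.Icc a b) := by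
    rintro p ⟨hp, hp1, hp2⟩
    rw [abs_le] at hp1 hp2
    have key : ∀ k, a k ≤ M.mulVec p k ∧ M.mulVec p k ≤ b k := by
      intro k
      by_cases hki : k = i
      · subst hki
        rw [hi]; simp only [a, b, if_true]; constructor <;> linarith
      · by_cases hkj : k = j
        · subst hkj
          rw [hj]; simp only [a, b, hki, if_true, if_false]; constructor <;> linarith
        · rw [hk p k hki hkj]; simp only [a, b, hki, hkj, if_false]
          exact abs_le.1 (hp k)
    exact ⟨fun k => by simpa using (key k).1, fun k => by simpa using (key k).2⟩
  have hdet : LinearMap.det (Matrix.toLin' M) ≠ 0 := by rw [LinearMap.det_toLin', hM]; exact hd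
  have hvol := Measure.addHaar_preimage_linearMap (volume : Measure (Fin m → ℝ)) hdet (Set.Icc a b)
  have hab : ∀ k, b k - a k = 4 * (if k = i then e1 / 2 else 1) * (if k = j then e2 / 2 else 1) := by
    intro k
    by_cases hki : k = i
    · subst hki
      simp [a, b, hij]; ring
    · by_cases hkj : k = j
      · subst hkj
        simp [a, b, hki]; ring
      · simp [a, b, hki, hkj]; norm_num
  have hab0 : ∀ k, 0 ≤ b k - a k := by
    intro k; rw [hab]; split_ifs <;> positivity
  have hle : volume (Bs u v c1 c2 e1 e2) ≤
      ENNReal.ofReal (4 ^ m * (e1 * e2 / |u i * v j - u j * v i|)) := by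
    refine (measure_mono hsub).trans ?_
    rw [hvol, Real.volume_Icc_pi, ← ENNReal.ofReal_prod_of_nonneg (fun k _ => hab0 k),
      ← ENNReal.ofReal_mul (abs_nonneg _)]
    apply ENNReal.ofReal_le_ofReal
    simp_rw [hab]
    rw [Finset.prod_mul_distrib, Finset.prod_mul_distrib]
    simp only [Finset.prod_const, Finset.card_univ, Fintype.card_fin, Finset.prod_ite_eq',
      Finset.mem_univ, if_true]
    rw [LinearMap.det_toLin', hM, abs_inv]
    have : 0 ≤ |u i * v j - u j * v i|⁻¹ * (4 ^ m * e1 * e2) := by positivity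
    have e : 4 ^ m * (e1 * e2 / |u i * v j - u j * v i|) =
        |u i * v j - u j * v i|⁻¹ * (4 ^ m * e1 * e2) := by rw [div_eq_mul_inv]; ring
    rw [e]
    linarith
  exact ENNReal.toReal_le_of_le_ofReal (by positivity) hle

lemma int_bound1 {m : ℕ} (g : (Fin m → ℝ) → ℝ) (S : Set (Fin m → ℝ)) (hS : volume S < ⊤)
    (M V : ℝ) (hM : 0 ≤ M) (hV : volume.real S ≤ V)
    (h0 : ∀ p, p ∉ S → g p = 0) (h1 : ∀ p ∈ S, |g p| ≤ M) : |∫ p, g p| ≤ M * V := by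
  rw [← setIntegral_eq_integral_of_forall_compl_eq_zero h0]
  exact (norm_setIntegral_le_of_norm_le_const (f := g) hS h1).trans (by gcongr)

lemma int_bound2 {m : ℕ} (g : (Fin m → ℝ) → ℝ) (S T : Set (Fin m → ℝ)) (hS : volume S < ⊤)
    (hT : volume T < ⊤) (mS : MeasurableSet S) (mT : MeasurableSet T)
    (M V N W : ℝ) (hM : 0 ≤ M) (hN : 0 ≤ N) (hV : volume.real S ≤ V) (hW : volume.real T ≤ W)
    (h1 : ∀ p, |g p| ≤ S.indicator (fun _ => M) p + T.indicator (fun _ => N) p) :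
    |∫ p, g p| ≤ M * V + N * W := by
  have i1 : Integrable (S.indicator (fun _ => M)) (volume : Measure (Fin m → ℝ)) :=
    (integrable_indicator_iff mS).2 (integrableOn_const hS.ne)
  have i2 : Integrable (T.indicator (fun _ => N)) (volume : Measure (Fin m → ℝ)) :=
    (integrable_indicator_iff mT).2 (integrableOn_const hT.ne)
  have := norm_integral_le_of_norm_le (f := g) (i1.add i2) (Filter.Eventually.of_forall (f := ae volume) h1)
  refine this.trans ?_
  simp only [Pi.add_apply]
  rw [integral_add i1 i2, integral_indicator_const _ mS, integral_indicator_const _ mT,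
    smul_eq_mul, smul_eq_mul, mul_comm, mul_comm _ N]
  gcongr

noncomputable def Pf {m : ℕ} (t : ℝ) (p : Fin m → ℝ) : ℝ := ∑ i : Fin m, t ^ ((i : ℕ) + 1) * p i

noncomputable def Qf {m : ℕ} (t : ℝ) (p : Fin m → ℝ) : ℝ :=
  ∑ i : Fin m, (((i : ℕ) + 1 : ℝ) * t ^ (i : ℕ)) * p i

lemma Pf_cont {m : ℕ} (t : ℝ) : Continuous (Pf (m := m) t) := by unfold Pf; fun_prop
lemma Qf_cont {m : ℕ} (t : ℝ) : Continuous (Qf (m := m) t) := by unfold Qf; fun_prop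

lemma Pf_neg {m : ℕ} (t : ℝ) (p : Fin m → ℝ) : Pf t (-p) = - Pf t p := by
  simp [Pf]
lemma Qf_neg {m : ℕ} (t : ℝ) (p : Fin m → ℝ) : Qf t (-p) = - Qf t p := by
  simp [Qf]

/-- the shift vector -/
noncomputable def sv (k : ℕ) (s : ℝ) : Fin (k + 2) → ℝ := Pi.single (Fin.last (k + 1)) s

lemma Pf_sub {k : ℕ} (t s : ℝ) (p : Fin (k + 2) → ℝ) :
    Pf t (p - sv k s) = Pf t p - t ^ (k + 2) * s := by
  simp [Pf, sv, mul_sub, Finset.sum_sub_distrib, Pi.single_apply]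

lemma Qf_sub {k : ℕ} (t s : ℝ) (p : Fin (k + 2) → ℝ) :
    Qf t (p - sv k s) = Qf t p - (k + 2) * t ^ (k + 1) * s := by
  have : ((k : ℝ) + 1 + 1) = k + 2 := by ring
  simp [Qf, sv, mul_sub, Finset.sum_sub_distrib, Pi.single_apply, this]

open Classical in
noncomputable def cf {m : ℕ} (p : Fin m → ℝ) : ℝ := if ∀ i, |p i| ≤ 1 then 1 else 0

open Classical in
noncomputable def hf {m : ℕ} (t b : ℝ) (p : Fin m → ℝ) : ℝ := if |Pf t p| ≤ 1 then |Qf t p + b| else 0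

lemma cf_neg {m : ℕ} (p : Fin m → ℝ) : cf (-p) = cf p := by
  simp [cf]

lemma hf_neg {m : ℕ} (t b : ℝ) (p : Fin m → ℝ) : hf t b (-p) = hf t (-b) p := by
  have : |-Qf t p + b| = |Qf t p + -b| := by rw [← abs_neg]; congr 1; ring
  simp only [hf, Pf_neg, Qf_neg, abs_neg, this]

lemma integ {m : ℕ} (t b : ℝ) (v : Fin m → ℝ) :
    Integrable (fun p => cf p * hf t b (p - v)) := by
  have hK : IsCompact {p : Fin m → ℝ | (∀ i, |p i| ≤ 1) ∧ |Pf t (p - v)| ≤ 1} := by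
    have h1 : IsCompact (Set.Icc (fun _ => -1 : Fin m → ℝ) (fun _ => 1)) := isCompact_Icc
    have h2 : IsClosed {p : Fin m → ℝ | |Pf t (p - v)| ≤ 1} := by
      have := Pf_cont (m := m) t
      exact isClosed_le (by fun_prop) (by fun_prop)
    convert h1.inter_right h2 using 1
    ext p
    simp [Pi.le_def, abs_le, forall_and]
  have hc : Continuous fun p : Fin m → ℝ => |Qf t (p - v) + b| := by
    have := Qf_cont (m := m) t
    fun_prop
  have := (integrable_indicator_iff hK.measurableSet).2
    (hc.continuousOn.integrableOn_compact (μ := volume) hK)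
  refine this.congr (Filter.Eventually.of_forall fun p => ?_)
  by_cases h1 : ∀ i, |p i| ≤ 1 <;> by_cases h2 : |Pf t (p - v)| ≤ 1 <;>
    simp [cf, hf, h1, h2, Set.indicator]

lemma integ' {m : ℕ} (t b : ℝ) (v : Fin m → ℝ) :
    Integrable (fun p => cf (p - v) * hf t b p) := by
  have := (integ t b (-v)).comp_sub_right v
  simpa using this

lemma omega_eq0 (k : ℕ) (ξ t : ℝ) : omegaFn (k + 3) ξ t =
    ∫ p : Fin (k + 2) → ℝ, Set.indicator {p | (∀ i, |p i| ≤ 1) ∧ |ξ * t ^ (k + 3) + Pf t p| ≤ 1}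
      (fun p => |(k + 3) * ξ * t ^ (k + 2) + Qf t p|) p := by
  have hm : MeasurableSet {p : Fin (k + 2) → ℝ | (∀ i, |p i| ≤ 1) ∧ |ξ * t ^ (k + 3) + Pf t p| ≤ 1} := by
    have : IsClosed {p : Fin (k + 2) → ℝ | (∀ i, |p i| ≤ 1) ∧ |ξ * t ^ (k + 3) + Pf t p| ≤ 1} := by
      simp only [Set.ofPred_and, Set.ofPred_forall]
      have := Pf_cont (m := k + 2) t
      refine IsClosed.inter (isClosed_iInter fun k => ?_) ?_
      all_goals exact isClosed_le (by fun_prop) (by fun_prop)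
    exact this.measurableSet
  rw [integral_indicator hm]
  have e1 : ∀ p : Fin (k + 2) → ℝ, Pf t p = ∑ i, p i * t ^ ((i : ℕ) + 1) := by
    intro p; simp only [Pf]; exact Finset.sum_congr rfl fun i _ => by ring
  have e2 : ∀ p : Fin (k + 2) → ℝ, Qf t p = ∑ i : Fin (k + 2), ((i : ℕ) + 1 : ℝ) * p i * t ^ (i : ℕ) := by
    intro p; simp only [Qf]; exact Finset.sum_congr rfl fun i _ => by ring
  simp only [e1, e2]
  unfold omegaFn Dset
  push_cast
  rfl

lemma phi_eq (k : ℕ) (t : ℝ) : phiFn (k + 2) t = omegaFn (k + 3) 0 t := by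
  unfold phiFn omegaFn Dset Gset
  simp

lemma omega_eq (k : ℕ) (ξ t : ℝ) : omegaFn (k + 3) ξ t =
    ∫ p, cf (p - sv k (ξ * t)) * hf t (ξ * t ^ (k + 2)) p := by
  rw [omega_eq0, ← integral_sub_right_eq_self _ (sv k (ξ * t))]
  congr 1
  ext p
  have e1 : ξ * t ^ (k + 3) + Pf t (p - sv k (ξ * t)) = Pf t p := by rw [Pf_sub]; ring
  have e2 : (k + 3) * ξ * t ^ (k + 2) + Qf t (p - sv k (ξ * t)) = Qf t p + ξ * t ^ (k + 2) := by
    rw [Qf_sub]; ring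
  by_cases h1 : ∀ i, |(p - sv k (ξ * t)) i| ≤ 1 <;> by_cases h2 : |Pf t p| ≤ 1 <;>
    simp only [cf, hf, h1, h2, Set.indicator, e1, e2, Set.mem_ofPred_eq, and_self, and_true, and_false, if_true, if_false,
      one_mul, zero_mul, mul_zero, implies_true]

lemma sv_zero (k : ℕ) : sv k 0 = 0 := by simp [sv]

lemma diff_id (k : ℕ) (ξ t : ℝ) : 2 * (omegaFn (k + 3) ξ t - phiFn (k + 2) t) =
    (∫ p : Fin (k + 2) → ℝ, cf p * (hf t (ξ * t ^ (k + 2)) p + hf t (-(ξ * t ^ (k + 2))) p - 2 * hf t 0 p)) +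
    ∫ p, (cf (p - sv k (ξ * t)) - cf p) *
      (hf t (ξ * t ^ (k + 2)) p - hf t (-(ξ * t ^ (k + 2))) (p - sv k (ξ * t))) := by
  rw [phi_eq, omega_eq k 0]
  have X2 : omegaFn (k + 3) ξ t =
      ∫ p, cf p * hf t (-(ξ * t ^ (k + 2))) (p - sv k (ξ * t)) := by
    rw [omega_eq, ← integral_sub_left_eq_self
      (fun p => cf p * hf t (-(ξ * t ^ (k + 2))) (p - sv k (ξ * t))) volume (sv k (ξ * t))]
    congr 1
    ext p
    rw [← cf_neg (p - _), neg_sub, ← hf_neg]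
    congr 2
    abel
  simp only [zero_mul, sv_zero, sub_zero]
  have X1 := omega_eq k ξ t
  generalize ξ * t ^ (k + 2) = a at *
  generalize sv k (ξ * t) = v at *
  have hX1 := integ' t a v
  have hX2 := integ t (-a) v
  have i0 : ∀ b, Integrable (fun p : Fin (k + 2) → ℝ => cf p * hf t b p) := by
    intro b; simpa using integ (m := k + 2) t b 0
  have i1 : Integrable (fun p : Fin (k + 2) → ℝ => cf (p - v) * hf t (-a) (p - v)) :=
    (i0 (-a)).comp_sub_right v
  have E1 : (∫ p : Fin (k + 2) → ℝ, cf p * (hf t a p + hf t (-a) p - 2 * hf t 0 p)) =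
      (∫ p : Fin (k + 2) → ℝ, cf p * hf t a p) + (∫ p : Fin (k + 2) → ℝ, cf p * hf t (-a) p)
        - 2 * ∫ p : Fin (k + 2) → ℝ, cf p * hf t 0 p := by
    rw [← integral_const_mul, ← integral_add (i0 a) (i0 (-a)),
      ← integral_sub (f := fun p => cf p * hf t a p + cf p * hf t (-a) p) ((i0 a).add (i0 (-a))) ((i0 0).const_mul 2)]
    congr 1
    ext p
    ring
  have E3 : (∫ p : Fin (k + 2) → ℝ, cf (p - v) * hf t (-a) (p - v)) =
      ∫ p : Fin (k + 2) → ℝ, cf p * hf t (-a) p :=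
    integral_sub_right_eq_self (fun p => cf p * hf t (-a) p) v
  have E2 : (∫ p : Fin (k + 2) → ℝ, (cf (p - v) - cf p) * (hf t a p - hf t (-a) (p - v))) =
      (∫ p, cf (p - v) * hf t a p) - (∫ p, cf (p - v) * hf t (-a) (p - v)) -
        ((∫ p : Fin (k + 2) → ℝ, cf p * hf t a p) - ∫ p, cf p * hf t (-a) (p - v)) := by
    rw [← integral_sub hX1 i1, ← integral_sub (i0 a) hX2,
      ← integral_sub (f := fun p => cf (p - v) * hf t a p - cf (p - v) * hf t (-a) (p - v))
        (g := fun p => cf p * hf t a p - cf p * hf t (-a) (p - v)) (hX1.sub i1) ((i0 a).sub hX2)]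
    congr 1
    ext p
    ring
  rw [E1, E2, E3, ← X1, ← X2]
  ring

noncomputable def pc (m : ℕ) (t : ℝ) : Fin m → ℝ := fun i => t ^ ((i : ℕ) + 1)
noncomputable def qc (m : ℕ) (t : ℝ) : Fin m → ℝ := fun i => ((i : ℕ) + 1 : ℝ) * t ^ (i : ℕ)

lemma abs2 (x a : ℝ) : abs (|x + a| + |x + -a| - 2 * |x|) ≤ 2 * |a| := by
  rw [abs_le]
  cases abs_cases (x + a) <;> cases abs_cases (x + -a) <;> cases abs_cases x <;> cases abs_cases a <;>
    constructor <;> linarith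

lemma abs2' (x a : ℝ) (h : |a| < |x|) : |x + a| + |x + -a| - 2 * |x| = 0 := by
  cases abs_cases (x + a) <;> cases abs_cases (x + -a) <;> cases abs_cases x <;> cases abs_cases a <;>
    linarith

lemma I1_bound (k : ℕ) (t a : ℝ) (ht : t ≠ 0) :
    |∫ p : Fin (k + 2) → ℝ, cf p * (hf t a p + hf t (-a) p - 2 * hf t 0 p)| ≤
      2 * |a| * (4 ^ (k + 2) * (|a| * 1 / |t| ^ (2 * k + 2))) := by
  have hdet : qc (k + 2) t (Fin.castSucc (Fin.last k)) * pc (k + 2) t (Fin.last (k + 1)) -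
      qc (k + 2) t (Fin.last (k + 1)) * pc (k + 2) t (Fin.castSucc (Fin.last k)) = - t ^ (2 * k + 2) := by
    simp [qc, pc]; ring
  have hV := Bs_vol (Fin.castSucc (Fin.last k)) (Fin.last (k + 1)) (Fin.castSucc_lt_last _).ne
    (qc (k + 2) t) (pc (k + 2) t) 0 0 |a| 1 (abs_nonneg _) zero_le_one
    (by rw [hdet]; exact neg_ne_zero.2 (pow_ne_zero _ ht))
  rw [hdet, abs_neg, abs_pow] at hV
  refine int_bound1 _ (Bs (qc (k + 2) t) (pc (k + 2) t) 0 0 |a| 1) (Bs_fin _ _ _ _ _ _) _ _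
    (by positivity) hV ?_ ?_
  · intro p hp
    by_cases h1 : ∀ i, |p i| ≤ 1
    · by_cases h2 : |Pf t p| ≤ 1
      · have h3 : |a| < |Qf t p| := by
          by_contra h3
          exact hp ⟨fun i => (h1 i).trans (by norm_num), by rw [sub_zero]; exact not_lt.1 h3,
            by rw [sub_zero]; exact h2⟩
        simp only [hf, h2, if_true, add_zero, abs2' _ _ h3, mul_zero]
      · simp [hf, h2]
    · simp [cf, h1]
  · intro p _
    have hc : |cf p| ≤ 1 := by unfold cf; split_ifs <;> simp
    have : |hf t a p + hf t (-a) p - 2 * hf t 0 p| ≤ 2 * |a| := by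
      by_cases h2 : |Pf t p| ≤ 1
      · simp only [hf, h2, if_true, add_zero]; exact abs2 _ _
      · simp [hf, h2]
    rw [abs_mul]
    calc _ ≤ 1 * (2 * |a|) := by gcongr
      _ = _ := one_mul _

lemma cf_diff (k : ℕ) (s : ℝ) (hs : |s| ≤ 1) (p : Fin (k + 2) → ℝ)
    (h : cf (p - sv k s) - cf p ≠ 0) :
    (∀ i, |p i| ≤ 2) ∧ (∀ i, |(p - sv k s) i| ≤ 2) ∧
      (|p (Fin.last (k + 1)) - 1| ≤ |s| ∨ |p (Fin.last (k + 1)) - (-1)| ≤ |s|) := by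
  have hl : (p - sv k s) (Fin.last (k + 1)) = p (Fin.last (k + 1)) - s := by simp [sv]
  have ho : ∀ i, i ≠ Fin.last (k + 1) → (p - sv k s) i = p i := by
    intro i hi; simp [sv, hi]
  have hs' := abs_le.1 hs
  by_cases h1 : ∀ i, |(p - sv k s) i| ≤ 1 <;> by_cases h2 : ∀ i, |p i| ≤ 1
  · exact absurd (by simp only [cf, h1, h2, implies_true, if_true, sub_self]) h
  · obtain ⟨j, hj⟩ := not_forall.1 h2
    have hjl : j = Fin.last (k + 1) := by
      by_contra hjl
      exact hj (by rw [← ho j hjl]; exact h1 j)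
    subst hjl
    have hL := h1 (Fin.last (k + 1))
    rw [hl] at hL
    refine ⟨fun i => ?_, fun i => (h1 i).trans (by norm_num), ?_⟩
    · by_cases hi : i = Fin.last (k + 1)
      · subst hi; rw [abs_le] at *; constructor <;> linarith
      · rw [← ho i hi]; exact (h1 i).trans (by norm_num)
    · generalize p (Fin.last (k + 1)) = x at *
      rw [not_le] at hj
      rw [abs_le] at hL
      rcases lt_abs.1 hj with hx | hx
      · left; rw [abs_le]; constructor <;> linarith [le_abs_self s, abs_nonneg s]
      · right; rw [abs_le]; constructor <;> linarith [neg_abs_le s, abs_nonneg s]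
  · obtain ⟨j, hj⟩ := not_forall.1 h1
    have hjl : j = Fin.last (k + 1) := by
      by_contra hjl
      exact hj (by rw [ho j hjl]; exact h2 j)
    subst hjl
    have hL := h2 (Fin.last (k + 1))
    rw [hl] at hj
    refine ⟨fun i => (h2 i).trans (by norm_num), fun i => ?_, ?_⟩
    · by_cases hi : i = Fin.last (k + 1)
      · subst hi; rw [hl]; rw [abs_le] at *; constructor <;> linarith
      · rw [ho i hi]; exact (h2 i).trans (by norm_num)
    · generalize p (Fin.last (k + 1)) = x at *
      rw [not_le] at hj
      rw [abs_le] at hL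
      rcases lt_abs.1 hj with hx | hx
      · left; rw [abs_le]; constructor <;> linarith [neg_abs_le s, abs_nonneg s]
      · right; rw [abs_le]; constructor <;> linarith [le_abs_self s, abs_nonneg s]
  · exact absurd (by simp only [cf, h1, h2, if_false, sub_self]) h

lemma cf_diff_le {m : ℕ} (p q : Fin m → ℝ) : |cf p - cf q| ≤ 1 := by
  unfold cf; split_ifs <;> simp

/-- large `t`: boundary term vanishes pointwise -/
lemma Pf_big (k : ℕ) (t : ℝ) (ht : 4 * (k + 1) + 4 ≤ |t|) (q : Fin (k + 2) → ℝ)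
    (hq : ∀ i, |q i| ≤ 2) (hL : 1 / 2 ≤ |q (Fin.last (k + 1))|) : 1 < |Pf t q| := by
  have h1 : (1 : ℝ) ≤ |t| := by have : (0 : ℝ) ≤ k := by positivity
                                linarith
  unfold Pf
  rw [Fin.sum_univ_castSucc]
  have hb : |∑ i : Fin (k + 1), t ^ ((i.castSucc : ℕ) + 1) * q i.castSucc| ≤ (k + 1) * (|t| ^ (k + 1) * 2) := by
    refine (Finset.abs_sum_le_sum_abs _ _).trans ?_
    calc _ ≤ ∑ i : Fin (k + 1), |t| ^ (k + 1) * 2 := by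
          refine Finset.sum_le_sum fun i _ => ?_
          rw [abs_mul, abs_pow]
          refine mul_le_mul (pow_le_pow_right₀ h1 ?_) (hq _) (abs_nonneg _) (by positivity)
          have := i.2
          simp only [Fin.val_castSucc]; omega
      _ = _ := by simp
  have hl : |t| ^ (k + 2) * (1 / 2) ≤ |t ^ ((Fin.last (k + 1) : ℕ) + 1) * q (Fin.last (k + 1))| := by
    rw [abs_mul, abs_pow, Fin.val_last]
    gcongr
  have h3 := abs_sub_abs_le_abs_sub (t ^ ((Fin.last (k + 1) : ℕ) + 1) * q (Fin.last (k + 1)))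
    (-∑ i : Fin (k + 1), t ^ ((i.castSucc : ℕ) + 1) * q i.castSucc)
  rw [abs_neg, sub_neg_eq_add, add_comm (t ^ _ * _)] at h3
  have h4 : (1 : ℝ) ≤ |t| ^ (k + 1) := one_le_pow₀ h1
  have h5 : |t| ^ (k + 2) = |t| ^ (k + 1) * |t| := pow_succ _ _
  refine lt_of_lt_of_le ?_ h3
  nlinarith

lemma J_zero (k : ℕ) (t s a b : ℝ) (ht : 4 * (k + 1) + 4 ≤ |t|) (hs : |s| ≤ 1 / 4) :
    ∫ p, (cf (p - sv k s) - cf p) * (hf t a p - hf t b (p - sv k s)) = 0 := by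
  rw [integral_eq_zero_of_ae]
  refine Filter.Eventually.of_forall fun p => ?_
  by_cases h : cf (p - sv k s) - cf p = 0
  · simp [h]
  · obtain ⟨h1, h2, h3⟩ := cf_diff k s (by linarith) p h
    have hl : (p - sv k s) (Fin.last (k + 1)) = p (Fin.last (k + 1)) - s := by simp [sv]
    have hs' := abs_le.1 hs
    have g1 : 1 < |Pf t p| := by
      refine Pf_big k t ht p h1 ?_
      rw [le_abs]
      rcases h3 with h3 | h3 <;> rw [abs_le] at h3
      · left; linarith
      · right; linarith
    have g2 : 1 < |Pf t (p - sv k s)| := by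
      refine Pf_big k t ht _ h2 ?_
      rw [le_abs, hl]
      rcases h3 with h3 | h3 <;> rw [abs_le] at h3
      · left; linarith
      · right; linarith
    simp [hf, not_le.2 g1, not_le.2 g2]

lemma union_vol {m : ℕ} (S T : Set (Fin m → ℝ)) (V W : ℝ) (hS : volume.real S ≤ V)
    (hT : volume.real T ≤ W) : volume.real (S ∪ T) ≤ V + W :=
  (measureReal_union_le S T).trans (add_le_add hS hT)

lemma hf_le (k : ℕ) (t T b : ℝ) (hT : 1 ≤ T) (ht : |t| ≤ T) (hb : |b| ≤ T ^ (k + 2))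
    (q : Fin (k + 2) → ℝ) (hq : ∀ i, |q i| ≤ 2) :
    |Qf t q + b| ≤ (k + 2) * ((k + 2) * T ^ (k + 2) * 2) + T ^ (k + 2) := by
  refine (abs_add_le _ _).trans (add_le_add ?_ hb)
  unfold Qf
  refine (Finset.abs_sum_le_sum_abs _ _).trans ?_
  calc _ ≤ ∑ i : Fin (k + 2), (((k : ℝ) + 2) * T ^ (k + 2) * 2) := by
        refine Finset.sum_le_sum fun i _ => ?_
        rw [abs_mul, abs_mul, abs_pow]
        have hi : ((i : ℕ) : ℝ) + 1 ≤ k + 2 := by exact_mod_cast i.2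
        have hi2 : |t| ^ (i : ℕ) ≤ T ^ (k + 2) :=
          (pow_le_pow_left₀ (abs_nonneg t) ht _).trans (pow_le_pow_right₀ hT i.2.le)
        rw [abs_of_nonneg (by positivity : (0 : ℝ) ≤ ((i : ℕ) : ℝ) + 1)]
        have := hq i
        gcongr
    _ = _ := by simp

noncomputable def ev {m : ℕ} (i : Fin m) : Fin m → ℝ := Pi.single i 1

lemma ev_sum {m : ℕ} (i : Fin m) (p : Fin m → ℝ) : ∑ j, ev i j * p j = p i := by
  simp [ev, Pi.single_apply]

lemma J_bound (k : ℕ) (t s T a : ℝ) (h0 : t ≠ 0) (hT : 1 ≤ T) (ht : |t| ≤ T) (hs : |s| ≤ 1)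
    (ha : a = t ^ (k + 1) * s) (hb : |a| ≤ T ^ (k + 2)) :
    |∫ p, (cf (p - sv k s) - cf p) * (hf t a p - hf t (-a) (p - sv k s))| ≤
    ((k + 4) * |a|) * (4 ^ (k + 2) * (|s| * 2 / 1) + 4 ^ (k + 2) * (|s| * 2 / 1)) +
    ((k + 2) * ((k + 2) * T ^ (k + 2) * 2) + T ^ (k + 2)) *
      ((4 ^ (k + 2) * (|s| * |t ^ (k + 2) * s| / |t|) + 4 ^ (k + 2) * (|s| * |t ^ (k + 2) * s| / |t|)) +
       (4 ^ (k + 2) * (|s| * |t ^ (k + 2) * s| / |t|) + 4 ^ (k + 2) * (|s| * |t ^ (k + 2) * s| / |t|))) := by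
  set L : Fin (k + 2) := Fin.last (k + 1) with hLdef
  have hL0 : L ≠ 0 := by rw [hLdef]; exact (Fin.last_pos).ne'
  have V1 : ∀ c, volume.real (Bs (ev L) (ev 0) c 0 |s| 2) ≤ 4 ^ (k + 2) * (|s| * 2 / 1) := by
    intro c
    have hd : ev L L * ev (0 : Fin (k + 2)) 0 - ev L 0 * ev (0 : Fin (k + 2)) L = 1 := by
      simp [ev, hL0]
    have := Bs_vol L 0 hL0 (ev L) (ev 0) c 0 |s| 2 (abs_nonneg _) (by norm_num) (by rw [hd]; norm_num)
    rwa [hd, abs_one] at this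
  have V2 : ∀ c d, volume.real (Bs (ev L) (pc (k + 2) t) c d |s| |t ^ (k + 2) * s|) ≤
      4 ^ (k + 2) * (|s| * |t ^ (k + 2) * s| / |t|) := by
    intro c d
    have hd : ev L L * pc (k + 2) t 0 - ev L 0 * pc (k + 2) t L = t := by
      simp [ev, pc, hL0.symm]
    have := Bs_vol L 0 hL0 (ev L) (pc (k + 2) t) c d |s| |t ^ (k + 2) * s| (abs_nonneg _)
      (abs_nonneg _) (by rw [hd]; exact h0)
    rwa [hd] at this
  set N : ℝ := (k + 2) * ((k + 2) * T ^ (k + 2) * 2) + T ^ (k + 2) with hN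
  have hN0 : 0 ≤ N := by positivity
  refine int_bound2 _ (Bs (ev L) (ev 0) 1 0 |s| 2 ∪ Bs (ev L) (ev 0) (-1) 0 |s| 2)
    ((Bs (ev L) (pc (k + 2) t) 1 1 |s| |t ^ (k + 2) * s| ∪
      Bs (ev L) (pc (k + 2) t) 1 (-1) |s| |t ^ (k + 2) * s|) ∪
     (Bs (ev L) (pc (k + 2) t) (-1) 1 |s| |t ^ (k + 2) * s| ∪
      Bs (ev L) (pc (k + 2) t) (-1) (-1) |s| |t ^ (k + 2) * s|))
    (measure_union_lt_top (Bs_fin _ _ _ _ _ _) (Bs_fin _ _ _ _ _ _))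
    (measure_union_lt_top (measure_union_lt_top (Bs_fin _ _ _ _ _ _) (Bs_fin _ _ _ _ _ _))
      (measure_union_lt_top (Bs_fin _ _ _ _ _ _) (Bs_fin _ _ _ _ _ _)))
    ((Bs_meas _ _ _ _ _ _).union (Bs_meas _ _ _ _ _ _))
    (((Bs_meas _ _ _ _ _ _).union (Bs_meas _ _ _ _ _ _)).union
      ((Bs_meas _ _ _ _ _ _).union (Bs_meas _ _ _ _ _ _)))
    _ _ _ _ (by positivity) hN0 (union_vol _ _ _ _ (V1 _) (V1 _))
    (union_vol _ _ _ _ (union_vol _ _ _ _ (V2 _ _) (V2 _ _)) (union_vol _ _ _ _ (V2 _ _) (V2 _ _))) ?_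
  intro p
  set S := (Bs (ev L) (ev 0) 1 0 |s| 2 ∪ Bs (ev L) (ev 0) (-1) 0 |s| 2) with hS
  set U := ((Bs (ev L) (pc (k + 2) t) 1 1 |s| |t ^ (k + 2) * s| ∪
      Bs (ev L) (pc (k + 2) t) 1 (-1) |s| |t ^ (k + 2) * s|) ∪
     (Bs (ev L) (pc (k + 2) t) (-1) 1 |s| |t ^ (k + 2) * s| ∪
      Bs (ev L) (pc (k + 2) t) (-1) (-1) |s| |t ^ (k + 2) * s|)) with hU
  have n1 : 0 ≤ S.indicator (fun _ => (k + 4) * |a|) p :=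
    Set.indicator_nonneg (fun _ _ => by positivity) _
  have n2 : 0 ≤ U.indicator (fun _ => N) p := Set.indicator_nonneg (fun _ _ => hN0) _
  by_cases h : cf (p - sv k s) - cf p = 0
  · rw [h, zero_mul, abs_zero]; positivity
  obtain ⟨h1, h2, h3⟩ := cf_diff k s hs p h
  have hle : |(cf (p - sv k s) - cf p) * (hf t a p - hf t (-a) (p - sv k s))| ≤
      |hf t a p - hf t (-a) (p - sv k s)| := by
    rw [abs_mul]
    exact mul_le_of_le_one_left (abs_nonneg _) (cf_diff_le _ _)
  refine hle.trans ?_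
  have hU' : (|Pf t p - 1| ≤ |t ^ (k + 2) * s| ∨ |Pf t p - (-1)| ≤ |t ^ (k + 2) * s|) → p ∈ U := by
    rintro (hp | hp) <;> rcases h3 with h3 | h3
    · exact Or.inl (Or.inl ⟨h1, by rw [ev_sum]; exact h3, hp⟩)
    · exact Or.inr (Or.inl ⟨h1, by rw [ev_sum]; exact h3, hp⟩)
    · exact Or.inl (Or.inr ⟨h1, by rw [ev_sum]; exact h3, hp⟩)
    · exact Or.inr (Or.inr ⟨h1, by rw [ev_sum]; exact h3, hp⟩)
  by_cases g1 : |Pf t p| ≤ 1 <;> by_cases g2 : |Pf t (p - sv k s)| ≤ 1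
  · have hpS : p ∈ S := by
      rcases h3 with h3 | h3
      · exact Or.inl ⟨h1, by rw [ev_sum]; exact h3, by rw [ev_sum, sub_zero]; exact h1 0⟩
      · exact Or.inr ⟨h1, by rw [ev_sum]; exact h3, by rw [ev_sum, sub_zero]; exact h1 0⟩
    rw [Set.indicator_of_mem hpS]
    simp only [hf, g1, g2, if_true]
    have : |(|Qf t p + a| - |Qf t (p - sv k s) + -a|)| ≤ (k + 4) * |a| := by
      refine (abs_abs_sub_abs_le_abs_sub _ _).trans ?_
      rw [Qf_sub]
      have e : Qf t p + a - (Qf t p - (k + 2) * t ^ (k + 1) * s + -a) = (k + 4) * a := by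
        rw [ha]; ring
      rw [e, abs_mul, abs_of_nonneg (by positivity : (0 : ℝ) ≤ (k : ℝ) + 4)]
    linarith
  · have hpU : p ∈ U := by
      apply hU'
      rw [Pf_sub] at g2
      generalize t ^ (k + 2) * s = y at *
      generalize Pf t p = x at *
      rw [not_le] at g2
      rw [abs_le] at g1
      rcases lt_abs.1 g2 with hx | hx
      · left; rw [abs_le]; constructor <;> linarith [neg_abs_le y, abs_nonneg y]
      · right; rw [abs_le]; constructor <;> linarith [le_abs_self y, abs_nonneg y]
    rw [Set.indicator_of_mem hpU]
    simp only [hf, g1, g2, if_true, if_false, sub_zero, abs_abs]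
    have := hf_le k t T a hT ht hb p h1
    linarith
  · have hpU : p ∈ U := by
      apply hU'
      rw [Pf_sub] at g2
      generalize t ^ (k + 2) * s = y at *
      generalize Pf t p = x at *
      rw [not_le] at g1
      rw [abs_le] at g2
      rcases lt_abs.1 g1 with hx | hx
      · left; rw [abs_le]; constructor <;> linarith [le_abs_self y, abs_nonneg y]
      · right; rw [abs_le]; constructor <;> linarith [neg_abs_le y, abs_nonneg y]
    rw [Set.indicator_of_mem hpU]
    simp only [hf, g1, g2, if_true, if_false, zero_sub, abs_neg, abs_abs]
    have := hf_le k t T (-a) hT ht (by rwa [abs_neg]) _ h2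
    linarith
  · simp only [hf, g1, g2, if_false, sub_self, abs_zero]; positivity

lemma omega_bound (k : ℕ) (ξ t : ℝ) (hξ : 0 ≤ ξ) (ht : 1 ≤ |t|) :
    |omegaFn (k + 3) ξ t| ≤ 4 ^ (k + 2) * (ξ + (k + 2) ^ 2 / t ^ 2) := by
  have h0 : t ≠ 0 := by rintro rfl; norm_num at ht
  have htp : 0 < |t| := abs_pos.2 h0
  have hl : (0 : Fin (k + 2)) ≠ Fin.last (k + 1) := (Fin.last_pos).ne
  have hd : ev (0 : Fin (k + 2)) 0 * pc (k + 2) t (Fin.last (k + 1)) -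
      ev (0 : Fin (k + 2)) (Fin.last (k + 1)) * pc (k + 2) t 0 = t ^ (k + 2) := by
    simp [ev, pc, hl.symm]
  have hV := Bs_vol 0 (Fin.last (k + 1)) hl (ev 0) (pc (k + 2) t) 0 (-(ξ * t ^ (k + 3))) 1 1
    zero_le_one zero_le_one (by rw [hd]; exact pow_ne_zero _ h0)
  rw [hd, abs_pow] at hV
  have key : ∀ p : Fin (k + 2) → ℝ, (∀ i, |p i| ≤ 1) → |ξ * t ^ (k + 3) + Pf t p| ≤ 1 →
      |(k + 3) * ξ * t ^ (k + 2) + Qf t p| ≤ ξ * |t| ^ (k + 2) + (k + 2) ^ 2 * |t| ^ k := by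
    intro p hp hP
    have e : t * ((k + 3) * ξ * t ^ (k + 2) + Qf t p) =
        (k + 2) * (ξ * t ^ (k + 3) + Pf t p) + ξ * t ^ (k + 3)
          - ∑ i : Fin (k + 2), ((k : ℝ) + 1 - (i : ℕ)) * t ^ ((i : ℕ) + 1) * p i := by
      have : t * Qf t p = (k + 2) * Pf t p -
          ∑ i : Fin (k + 2), ((k : ℝ) + 1 - (i : ℕ)) * t ^ ((i : ℕ) + 1) * p i := by
        unfold Pf Qf
        rw [Finset.mul_sum, Finset.mul_sum, ← Finset.sum_sub_distrib]
        exact Finset.sum_congr rfl fun i _ => by ring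
      rw [mul_add, this]; ring
    have hsum : |∑ i : Fin (k + 2), ((k : ℝ) + 1 - (i : ℕ)) * t ^ ((i : ℕ) + 1) * p i| ≤
        (k + 2) * ((k + 1) * |t| ^ (k + 1)) := by
      refine (Finset.abs_sum_le_sum_abs _ _).trans ?_
      calc _ ≤ ∑ i : Fin (k + 2), (((k : ℝ) + 1) * |t| ^ (k + 1)) := by
            refine Finset.sum_le_sum fun i _ => ?_
            rw [abs_mul, abs_mul, abs_pow]
            have hi : ((i : ℕ) : ℝ) + 1 ≤ k + 2 := by exact_mod_cast i.2
            have hi0 : (0 : ℝ) ≤ ((i : ℕ) : ℝ) := by positivity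
            rw [abs_of_nonneg (by linarith : (0 : ℝ) ≤ (k : ℝ) + 1 - (i : ℕ))]
            by_cases hik : (i : ℕ) = k + 1
            · rw [hik]; push_cast; simp only [sub_self, zero_mul]; positivity
            · have : |t| ^ ((i : ℕ) + 1) ≤ |t| ^ (k + 1) :=
                pow_le_pow_right₀ ht (by have := i.2; omega)
              calc _ ≤ ((k : ℝ) + 1) * |t| ^ (k + 1) * 1 := by
                    have := hp i
                    gcongr
                    linarith
                _ = _ := mul_one _
        _ = _ := by simp
    have hm : |t| * |(k + 3) * ξ * t ^ (k + 2) + Qf t p| ≤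
        |t| * (ξ * |t| ^ (k + 2) + (k + 2) ^ 2 * |t| ^ k) := by
      rw [← abs_mul, e]
      refine (abs_sub _ _).trans ?_
      have a1 := abs_add_le (((k : ℝ) + 2) * (ξ * t ^ (k + 3) + Pf t p)) (ξ * t ^ (k + 3))
      rw [abs_mul, abs_of_nonneg (by positivity : (0 : ℝ) ≤ (k : ℝ) + 2), abs_mul ξ, abs_of_nonneg hξ,
        abs_pow] at a1
      have a2 : ((k : ℝ) + 2) * |ξ * t ^ (k + 3) + Pf t p| ≤ (k + 2) * |t| ^ (k + 1) := by
        gcongr; exact hP.trans (one_le_pow₀ ht)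
      have a3 : |t| * (ξ * |t| ^ (k + 2) + (k + 2) ^ 2 * |t| ^ k) =
        ξ * |t| ^ (k + 3) + (k + 2) * |t| ^ (k + 1) + (k + 2) * ((k + 1) * |t| ^ (k + 1)) := by ring
      rw [a3]; linarith
    exact le_of_mul_le_mul_left hm htp
  rw [omega_eq0]
  have := int_bound1 (fun p : Fin (k + 2) → ℝ => Set.indicator {p | (∀ i, |p i| ≤ 1) ∧ |ξ * t ^ (k + 3) + Pf t p| ≤ 1}
      (fun p => |(k + 3) * ξ * t ^ (k + 2) + Qf t p|) p)
    (Bs (ev 0) (pc (k + 2) t) 0 (-(ξ * t ^ (k + 3))) 1 1) (Bs_fin _ _ _ _ _ _)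
    (ξ * |t| ^ (k + 2) + (k + 2) ^ 2 * |t| ^ k) _ (by positivity) hV ?_ ?_
  · refine this.trans (le_of_eq ?_)
    rw [← sq_abs t]
    field_simp
    ring
  · intro p hp
    refine Set.indicator_of_notMem (fun hp' => hp ⟨fun i => (hp'.1 i).trans (by norm_num), ?_, ?_⟩) _
    · rw [ev_sum, sub_zero]; exact hp'.1 0
    · have := hp'.2
      rwa [add_comm, ← sub_neg_eq_add] at this
  · intro p _
    by_cases hp : p ∈ {p : Fin (k + 2) → ℝ | (∀ i, |p i| ≤ 1) ∧ |ξ * t ^ (k + 3) + Pf t p| ≤ 1}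
    · rw [Set.indicator_of_mem hp, abs_abs]
      exact key p hp.1 hp.2
    · rw [Set.indicator_of_notMem hp, abs_zero]; positivity

lemma omega_zero (k : ℕ) (ξ t : ℝ) (hξ : 0 < ξ) (h1 : ξ < 1) (ht : (k + 3) / ξ < |t|) :
    omegaFn (k + 3) ξ t = 0 := by
  rw [div_lt_iff₀ hξ] at ht
  have h1t : 1 ≤ |t| := by
    have : (0 : ℝ) ≤ k := by positivity
    by_contra hh
    rw [not_le] at hh
    nlinarith [abs_nonneg t]
  rw [omega_eq0, integral_eq_zero_of_ae]
  refine Filter.Eventually.of_forall fun p => ?_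
  refine Set.indicator_of_notMem (fun hp => ?_) _
  have hb : |Pf t p| ≤ (k + 2) * |t| ^ (k + 2) := by
    unfold Pf
    refine (Finset.abs_sum_le_sum_abs _ _).trans ?_
    calc _ ≤ ∑ i : Fin (k + 2), |t| ^ (k + 2) := by
          refine Finset.sum_le_sum fun i _ => ?_
          rw [abs_mul, abs_pow]
          calc _ ≤ |t| ^ (k + 2) * 1 := by
                refine mul_le_mul (pow_le_pow_right₀ h1t ?_) (hp.1 i) (abs_nonneg _) (by positivity)
                have := i.2; omega
            _ = _ := mul_one _
      _ = _ := by simp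
  have h2 := hp.2
  have h3 := abs_sub_abs_le_abs_sub (ξ * t ^ (k + 3)) (-Pf t p)
  rw [abs_neg, sub_neg_eq_add, abs_mul, abs_of_pos hξ, abs_pow] at h3
  have h4 : (1 : ℝ) ≤ |t| ^ (k + 2) := one_le_pow₀ h1t
  have h5 : ξ * |t| ^ (k + 3) = (|t| * ξ) * |t| ^ (k + 2) := by ring
  nlinarith

theorem omega_phi_estimate (n : ℕ) (hn : 3 ≤ n) :
    ∃ κ₁ : ℝ, 0 < κ₁ ∧ ∃ κ₂ : ℝ, 0 < κ₂ ∧ ∃ C : ℝ, 0 < C ∧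
      ∀ ξ : ℝ, 0 < ξ → ξ < 1 → ∀ t : ℝ,
        (|t| ≤ κ₁ / Real.sqrt ξ → |omegaFn n ξ t - phiFn (n - 1) t| ≤ C * ξ ^ 2 * t ^ 2) ∧
        (κ₁ / Real.sqrt ξ < |t| → |t| ≤ κ₂ / ξ → |omegaFn n ξ t - phiFn (n - 1) t| ≤ C * ξ) ∧
        (κ₂ / ξ < |t| → |omegaFn n ξ t - phiFn (n - 1) t| ≤ C / t ^ 2) := by
  obtain ⟨k, rfl⟩ : ∃ k, n = k + 3 := ⟨n - 3, by omega⟩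
  change ∃ κ₁ : ℝ, 0 < κ₁ ∧ ∃ κ₂ : ℝ, 0 < κ₂ ∧ ∃ C : ℝ, 0 < C ∧
      ∀ ξ : ℝ, 0 < ξ → ξ < 1 → ∀ t : ℝ,
        (|t| ≤ κ₁ / Real.sqrt ξ → |omegaFn (k + 3) ξ t - phiFn (k + 2) t| ≤ C * ξ ^ 2 * t ^ 2) ∧
        (κ₁ / Real.sqrt ξ < |t| → |t| ≤ κ₂ / ξ → |omegaFn (k + 3) ξ t - phiFn (k + 2) t| ≤ C * ξ) ∧
        (κ₂ / ξ < |t| → |omegaFn (k + 3) ξ t - phiFn (k + 2) t| ≤ C / t ^ 2)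
  have hk0 : (0 : ℝ) ≤ k := by positivity
  obtain ⟨T, hTdef⟩ : ∃ T : ℝ, T = 4 * (k + 1) + 4 := ⟨_, rfl⟩
  have hT1 : 1 ≤ T := by linarith
  have hT0 : 0 < T := by linarith
  obtain ⟨N, hN⟩ : ∃ N : ℝ, N = (k + 2) * ((k + 2) * T ^ (k + 2) * 2) + T ^ (k + 2) := ⟨_, rfl⟩
  have hN0 : 0 ≤ N := by rw [hN]; positivity
  obtain ⟨CJ, hCJ⟩ : ∃ CJ : ℝ, CJ = ((k + 4) * 4 * 4 ^ (k + 2) + 4 * N * 4 ^ (k + 2)) * T ^ (k + 1) :=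
    ⟨_, rfl⟩
  have hCJ0 : 0 ≤ CJ := by rw [hCJ]; positivity
  obtain ⟨A, hA⟩ : ∃ A : ℝ, A = 4 ^ (k + 2) := ⟨_, rfl⟩
  have hA0 : 0 < A := by rw [hA]; positivity
  refine ⟨1, one_pos, k + 3, by positivity, A + CJ + A * (1 + 2 * (k + 2) ^ 2), by positivity, ?_⟩
  intro ξ hξ hξ1 t
  have hsq : 0 < Real.sqrt ξ := Real.sqrt_pos.2 hξ
  have hsq2 : Real.sqrt ξ * Real.sqrt ξ = ξ := Real.mul_self_sqrt hξ.le
  refine ⟨fun h => ?_, fun h _ => ?_, fun h => ?_⟩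
  · rw [le_div_iff₀ hsq] at h
    have hx : ξ * |t| ^ 2 ≤ 1 := by
      have : (|t| * Real.sqrt ξ) ^ 2 ≤ 1 := pow_le_one₀ (by positivity) h
      calc ξ * |t| ^ 2 = (|t| * Real.sqrt ξ) ^ 2 := by rw [mul_pow, sq (Real.sqrt ξ), hsq2, mul_comm]
        _ ≤ 1 := this
    have hid := diff_id k ξ t
    have hs : |ξ * t| = ξ * |t| := by rw [abs_mul, abs_of_pos hξ]
    have ha : |ξ * t ^ (k + 2)| = ξ * |t| ^ (k + 2) := by rw [abs_mul, abs_of_pos hξ, abs_pow]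
    have hs1 : |ξ * t| ≤ 1 := by
      rw [hs]
      have : (ξ * |t|) ^ 2 ≤ 1 := by
        calc (ξ * |t|) ^ 2 = ξ * (ξ * |t| ^ 2) := by ring
          _ ≤ 1 * 1 := by gcongr
          _ = 1 := one_mul 1
      exact (sq_le_one_iff₀ (by positivity)).1 this
    have hI : |∫ p : Fin (k + 2) → ℝ, cf p * (hf t (ξ * t ^ (k + 2)) p + hf t (-(ξ * t ^ (k + 2))) p - 2 * hf t 0 p)|
        ≤ 2 * A * (ξ ^ 2 * t ^ 2) := by
      by_cases h0 : t = 0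
      · subst h0; simp
        simp [← two_mul]
      · refine (I1_bound k t _ h0).trans (le_of_eq ?_)
        have : 0 < |t| := abs_pos.2 h0
        rw [ha, hA, ← sq_abs t]
        field_simp
        ring
    have hJ : |∫ p, (cf (p - sv k (ξ * t)) - cf p) *
      (hf t (ξ * t ^ (k + 2)) p - hf t (-(ξ * t ^ (k + 2))) (p - sv k (ξ * t)))| ≤ CJ * (ξ ^ 2 * t ^ 2) := by
      by_cases h0 : t = 0
      · subst h0; simp [sv_zero]
      have htp : 0 < |t| := abs_pos.2 h0
      rcases le_total T |t| with hTt | hTt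
      · rw [J_zero k t _ _ _ (by rw [← hTdef]; exact hTt), abs_zero]
        · positivity
        · rw [hs]
          have : (4 : ℝ) ≤ |t| := by linarith
          nlinarith [mul_pos hξ htp]
      · refine (J_bound k t (ξ * t) T _ h0 hT1 hTt hs1 (by ring) ?_).trans ?_
        · rw [ha]
          calc ξ * |t| ^ (k + 2) ≤ 1 * T ^ (k + 2) := by gcongr
            _ = _ := one_mul _
        · rw [← hN, ha, abs_mul (t ^ (k + 2)), hs, abs_pow]
          have e : (k + 4) * (ξ * |t| ^ (k + 2)) * (4 ^ (k + 2) * (ξ * |t| * 2 / 1) + 4 ^ (k + 2) * (ξ * |t| * 2 / 1)) +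
            N * ((4 ^ (k + 2) * (ξ * |t| * (|t| ^ (k + 2) * (ξ * |t|)) / |t|) + 4 ^ (k + 2) * (ξ * |t| * (|t| ^ (k + 2) * (ξ * |t|)) / |t|)) +
              (4 ^ (k + 2) * (ξ * |t| * (|t| ^ (k + 2) * (ξ * |t|)) / |t|) + 4 ^ (k + 2) * (ξ * |t| * (|t| ^ (k + 2) * (ξ * |t|)) / |t|)))
            = ((k + 4) * 4 * 4 ^ (k + 2) + 4 * N * 4 ^ (k + 2)) * |t| ^ (k + 1) * (ξ ^ 2 * |t| ^ 2) := by
            field_simp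
            ring
          rw [e, hCJ, ← sq_abs t]
          gcongr
    have hY : 0 ≤ ξ ^ 2 * t ^ 2 := by positivity
    have hb : |2 * (omegaFn (k + 3) ξ t - phiFn (k + 2) t)| ≤ 2 * A * (ξ ^ 2 * t ^ 2) + CJ * (ξ ^ 2 * t ^ 2) := by
      rw [hid]
      exact (abs_add_le _ _).trans (add_le_add hI hJ)
    rw [abs_mul, abs_two] at hb
    have z1 : 0 ≤ CJ * (ξ ^ 2 * t ^ 2) := by positivity
    have z2 : 0 ≤ A * (1 + 2 * ((k : ℝ) + 2) ^ 2) * (ξ ^ 2 * t ^ 2) := by positivity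
    have z3 : (A + CJ + A * (1 + 2 * ((k : ℝ) + 2) ^ 2)) * ξ ^ 2 * t ^ 2 =
      A * (ξ ^ 2 * t ^ 2) + CJ * (ξ ^ 2 * t ^ 2) + A * (1 + 2 * ((k : ℝ) + 2) ^ 2) * (ξ ^ 2 * t ^ 2) := by ring
    rw [z3]; linarith
  · rw [div_lt_iff₀ hsq] at h
    have hx : 1 < ξ * t ^ 2 := by
      have : 1 < (|t| * Real.sqrt ξ) ^ 2 := one_lt_pow₀ h (by norm_num)
      calc 1 < (|t| * Real.sqrt ξ) ^ 2 := this
        _ = ξ * t ^ 2 := by rw [mul_pow, sq (Real.sqrt ξ), hsq2, mul_comm, sq_abs]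
    have ht2 : 0 < t ^ 2 := by
      by_contra hh
      nlinarith [sq_nonneg t]
    have h1t : 1 ≤ |t| := by
      rw [← one_le_sq_iff_one_le_abs]
      nlinarith
    have b1 := omega_bound k ξ t hξ.le h1t
    have b2 := omega_bound k 0 t le_rfl h1t
    rw [← phi_eq] at b2
    rw [← hA] at b1 b2
    have b3 : ((k : ℝ) + 2) ^ 2 / t ^ 2 ≤ (k + 2) ^ 2 * ξ := by
      rw [div_le_iff₀ ht2]
      nlinarith [sq_nonneg ((k : ℝ) + 2)]
    have b4 := mul_le_mul_of_nonneg_left b3 hA0.le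
    have b5 : 0 ≤ CJ * ξ := by positivity
    have b6 : 0 ≤ A * ξ := by positivity
    refine (abs_sub _ _).trans ?_
    nlinarith
  · have h1t : 1 ≤ |t| := by
      rw [div_lt_iff₀ hξ] at h
      by_contra hh
      rw [not_le] at hh
      nlinarith [abs_nonneg t]
    rw [omega_zero k ξ t hξ hξ1 h, zero_sub, abs_neg]
    have b2 := omega_bound k 0 t le_rfl h1t
    rw [← phi_eq, ← hA, zero_add, ← mul_div_assoc] at b2
    refine b2.trans ?_
    gcongr
    nlinarith [mul_nonneg hA0.le (sq_nonneg ((k : ℝ) + 2))]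
end

section
/- Fix an integer n ≥ 3. There is a constant C(n) > 0 such that for all 0 < ξ < 1 and all t ∈ ℝ, |ω_n(ξ,t) − φ_{n−1}(t)| ≤ C(n)·ξ; in particular ω_n(ξ,·) converges uniformly on ℝ to φ_{n−1} as ξ → 0⁺. -/
open MeasureTheory Filter

lemma aux_slab {m : ℕ} (k : Fin m) (b : Fin m → ℝ) (hb : b k ≠ 0) (A : Fin m → Set ℝ)
    (a : Fin m → ℝ) (ha : ∀ i, 0 ≤ a i) (hA : ∀ i, i ≠ k → volume (A i) ≤ ENNReal.ofReal (a i)) :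
    volume {q : Fin m → ℝ | (∀ i, i ≠ k → q i ∈ A i) ∧ |∑ i, q i * b i| ≤ 1}
      ≤ ENNReal.ofReal (|b k|⁻¹ * ∏ i, Function.update a k 2 i) := by
  classical
  set T : Matrix (Fin m) (Fin m) ℝ := ((1 : Matrix (Fin m) (Fin m) ℝ).updateCol k b).transpose with hT
  have hdet : T.det = b k := by
    rw [hT, Matrix.det_transpose, ← Matrix.cramer_apply, Matrix.cramer_one]; rfl
  have hdet' : LinearMap.det (Matrix.toLin' T) = b k := by
    rw [LinearMap.det_toLin', hdet]
  have hTk : ∀ q : Fin m → ℝ, Matrix.toLin' T q k = ∑ i, q i * b i := by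
    intro q
    simp [hT, Matrix.mulVec, dotProduct, Matrix.updateCol_apply, mul_comm]
  have hTi : ∀ (q : Fin m → ℝ) i, i ≠ k → Matrix.toLin' T q i = q i := by
    intro q i hi
    simp [hT, Matrix.mulVec, dotProduct, Matrix.updateCol_apply, hi, Matrix.one_apply]
  have hset : {q : Fin m → ℝ | (∀ i, i ≠ k → q i ∈ A i) ∧ |∑ i, q i * b i| ≤ 1}
      = (Matrix.toLin' T) ⁻¹' (Set.univ.pi (Function.update A k (Set.Icc (-1) 1))) := by
    ext q
    simp only [Set.mem_ofPred_eq, Set.mem_preimage, Set.mem_univ_pi]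
    constructor
    · rintro ⟨h1, h2⟩ i
      by_cases hi : i = k
      · subst hi
        rw [hTk, Function.update_self]
        exact abs_le.1 h2
      · rw [hTi q i hi, Function.update_of_ne hi]
        exact h1 i hi
    · intro h
      constructor
      · intro i hi
        have := h i
        rwa [hTi q i hi, Function.update_of_ne hi] at this
      · have := h k
        rw [hTk, Function.update_self] at this
        exact abs_le.2 this
  rw [hset, Measure.addHaar_preimage_linearMap _ (by rw [hdet']; exact hb), hdet',
    volume_pi_pi, ENNReal.ofReal_mul (by positivity), abs_inv]
  have h0 : ∀ i ∈ Finset.univ, 0 ≤ Function.update a k 2 i := by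
    intro i _
    by_cases hi : i = k
    · subst hi; rw [Function.update_self]; norm_num
    · rw [Function.update_of_ne hi]; exact ha i
  rw [ENNReal.ofReal_prod_of_nonneg h0]
  gcongr with i
  by_cases hi : i = k
  · subst hi; rw [Function.update_self, Function.update_self, Real.volume_Icc]; norm_num
  · rw [Function.update_of_ne hi, Function.update_of_ne hi]; exact hA i hi

lemma aux_box {m : ℕ} (A : Fin m → Set ℝ)
    (a : Fin m → ℝ) (ha : ∀ i, 0 ≤ a i) (hA : ∀ i, volume (A i) ≤ ENNReal.ofReal (a i)) :
    volume (Set.univ.pi A) ≤ ENNReal.ofReal (∏ i, a i) := by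
  rw [volume_pi_pi, ENNReal.ofReal_prod_of_nonneg (fun i _ => ha i)]
  exact Finset.prod_le_prod' (fun i _ => hA i)

lemma aux_int {X : Type*} [MeasurableSpace X] (μ : Measure X) (A B S : Set X) (f g : X → ℝ)
    (c M VA VS : ℝ) (hc : 0 ≤ c) (hM : 0 ≤ M) (hVA : 0 ≤ VA) (hVS : 0 ≤ VS)
    (hA : MeasurableSet A) (hB : MeasurableSet B) (hS : MeasurableSet S)
    (hf : IntegrableOn f A μ) (hg : IntegrableOn g B μ)
    (hfg : ∀ x, |f x - g x| ≤ c)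
    (hgM : ∀ x, x ∈ A ∪ B → |g x| ≤ M)
    (hAS : ∀ x ∈ A, x ∉ B → x ∈ S) (hBS : ∀ x ∈ B, x ∉ A → x ∈ S)
    (h1 : μ A ≤ ENNReal.ofReal VA) (h2 : μ S ≤ ENNReal.ofReal VS) :
    |∫ x in A, f x ∂μ - ∫ x in B, g x ∂μ| ≤ c * VA + M * VS := by
  classical
  have hAt : μ A < ⊤ := h1.trans_lt ENNReal.ofReal_lt_top
  have hSt : μ S < ⊤ := h2.trans_lt ENNReal.ofReal_lt_top
  rw [← integral_indicator hA, ← integral_indicator hB,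
    ← integral_sub (hf.integrable_indicator hA) (hg.integrable_indicator hB)]
  have iA : Integrable (A.indicator (fun _ => c)) μ :=
    (integrableOn_const hAt.ne).integrable_indicator hA
  have iS : Integrable (S.indicator (fun _ => M)) μ :=
    (integrableOn_const hSt.ne).integrable_indicator hS
  have key := norm_integral_le_of_norm_le (f := fun x => A.indicator f x - B.indicator g x)
    (iA.add iS) (Eventually.of_forall (fun x => by
      simp only [Pi.add_apply, Real.norm_eq_abs]
      have hs0 : 0 ≤ S.indicator (fun _ => M) x := Set.indicator_nonneg (fun _ _ => hM) x
      by_cases ha : x ∈ A <;> by_cases hb : x ∈ B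
      · simp only [Set.indicator_of_mem ha, Set.indicator_of_mem hb]
        linarith [hfg x]
      · have := hAS x ha hb
        simp only [Set.indicator_of_mem ha, Set.indicator_of_notMem hb, Set.indicator_of_mem this]
        have h3 := hfg x
        have h4 := hgM x (Or.inl ha)
        have h5 := abs_add_le (f x - g x) (g x)
        simp only [sub_add_cancel] at h5
        simp only [sub_zero]
        linarith
      · have := hBS x hb ha
        simp only [Set.indicator_of_notMem ha, Set.indicator_of_mem hb, Set.indicator_of_mem this]
        have h4 := hgM x (Or.inr hb)
        simpa using h4
      · simp only [Set.indicator_of_notMem ha, Set.indicator_of_notMem hb]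
        simpa using hs0))
  rw [Real.norm_eq_abs] at key
  refine key.trans ?_
  simp only [Pi.add_apply]
  rw [integral_add iA iS, integral_indicator_const _ hA, integral_indicator_const _ hS]
  have e1 : μ.real A ≤ VA := ENNReal.toReal_le_of_le_ofReal hVA h1
  have e2 : μ.real S ≤ VS := ENNReal.toReal_le_of_le_ofReal hVS h2
  simp only [smul_eq_mul]
  nlinarith

lemma aux_ring (s : ℝ) (hs : 0 ≤ s) :
    volume {x : ℝ | |(|x| - 1)| ≤ s} ≤ ENNReal.ofReal (4 * s) := by
  have : {x : ℝ | |(|x| - 1)| ≤ s} ⊆ Set.Icc (1 - s) (1 + s) ∪ Set.Icc (-1 - s) (-1 + s) := by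
    intro x hx
    simp only [Set.mem_ofPred_eq, abs_le] at hx
    rcases abs_cases x with h | h
    · left; constructor <;> linarith
    · right; constructor <;> linarith
  refine (measure_mono this).trans ((measure_union_le _ _).trans ?_)
  rw [Real.volume_Icc, Real.volume_Icc, ← ENNReal.ofReal_add (by linarith) (by linarith)]
  apply ENNReal.ofReal_le_ofReal
  linarith

lemma aux_unit : volume {x : ℝ | |x| ≤ 1} ≤ ENNReal.ofReal 2 := by
  have : {x : ℝ | |x| ≤ 1} = Set.Icc (-1) 1 := by
    ext x; simp [abs_le]
  rw [this, Real.volume_Icc]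
  norm_num

lemma aux_unit_shift (s : ℝ) : volume {x : ℝ | |x - s| ≤ 1} ≤ ENNReal.ofReal 2 := by
  have : {x : ℝ | |x - s| ≤ 1} = Set.Icc (s-1) (s+1) := by
    ext x; simp only [Set.mem_ofPred_eq, abs_le, Set.mem_Icc]
    constructor <;> rintro ⟨h1, h2⟩ <;> constructor <;> linarith
  rw [this, Real.volume_Icc]
  apply ENNReal.ofReal_le_ofReal
  linarith

lemma aux_core (m : ℕ) (ξ t : ℝ) (hξ : 0 < ξ) (j : Fin m) (s M VA VS : ℝ)
    (hs : s = ξ * t ^ (m - (j : ℕ))) (hM : 0 ≤ M) (hVA : 0 ≤ VA) (hVS : 0 ≤ VS)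
    (hgM : ∀ q : Fin m → ℝ, (∀ i, i ≠ j → |q i| ≤ 1) → |q j| ≤ 1 + |s| →
      |∑ i, q i * t ^ ((i : ℕ) + 1)| ≤ 1 →
      |∑ i : Fin m, ((i : ℕ) + 1 : ℝ) * q i * t ^ (i : ℕ)| ≤ M)
    (h1 : volume {q : Fin m → ℝ | (∀ i, i ≠ j → |q i| ≤ 1) ∧ |q j - s| ≤ 1 ∧
      |∑ i, q i * t ^ ((i : ℕ) + 1)| ≤ 1} ≤ ENNReal.ofReal VA)
    (h2 : volume {q : Fin m → ℝ | (∀ i, i ≠ j → |q i| ≤ 1) ∧ |(|q j| - 1)| ≤ |s| ∧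
      |∑ i, q i * t ^ ((i : ℕ) + 1)| ≤ 1} ≤ ENNReal.ofReal VS) :
    |omegaFn (m + 1) ξ t - phiFn m t| ≤ ((m : ℝ) * ξ * |t| ^ m) * VA + M * VS := by
  classical
  set A := {q : Fin m → ℝ | (∀ i, i ≠ j → |q i| ≤ 1) ∧ |q j - s| ≤ 1 ∧
      |∑ i, q i * t ^ ((i : ℕ) + 1)| ≤ 1} with hAdef
  set S := {q : Fin m → ℝ | (∀ i, i ≠ j → |q i| ≤ 1) ∧ |(|q j| - 1)| ≤ |s| ∧
      |∑ i, q i * t ^ ((i : ℕ) + 1)| ≤ 1} with hSdef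
  have hjm : (j : ℕ) < m := j.2
  have e1 : s * t ^ ((j : ℕ) + 1) = ξ * t ^ (m + 1) := by
    rw [hs, mul_assoc, ← pow_add]; congr 2; omega
  have e2 : s * t ^ (j : ℕ) = ξ * t ^ m := by
    rw [hs, mul_assoc, ← pow_add]; congr 2; omega
  have hω : omegaFn (m + 1) ξ t = ∫ p in {p : Fin m → ℝ | (∀ i, |p i| ≤ 1) ∧
      |ξ * t ^ (m + 1) + ∑ i, p i * t ^ ((i : ℕ) + 1)| ≤ 1},
      |((m + 1 : ℕ) : ℝ) * ξ * t ^ m + ∑ i : Fin m, ((i : ℕ) + 1 : ℝ) * p i * t ^ (i : ℕ)| := rfl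
  have cl : ∀ (x : ℝ), IsClosed {p : Fin m → ℝ | (∀ i, |p i| ≤ 1) ∧
      |x + ∑ i, p i * t ^ ((i : ℕ) + 1)| ≤ 1} := by
    intro x
    simp only [Set.setOf_and, Set.setOf_forall]
    apply IsClosed.inter
    · exact isClosed_iInter fun i => isClosed_le (by fun_prop) (by fun_prop)
    · exact isClosed_le (by fun_prop) (by fun_prop)
  have clA : IsClosed A := by
    simp only [hAdef, Set.setOf_and, Set.setOf_forall]
    apply IsClosed.inter
    · exact isClosed_iInter fun i => isClosed_iInter fun _ =>
        isClosed_le (by fun_prop) (by fun_prop)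
    · exact (isClosed_le (by fun_prop) (by fun_prop)).inter (isClosed_le (by fun_prop) (by fun_prop))
  have clS : IsClosed S := by
    simp only [hSdef, Set.setOf_and, Set.setOf_forall]
    apply IsClosed.inter
    · exact isClosed_iInter fun i => isClosed_iInter fun _ =>
        isClosed_le (by fun_prop) (by fun_prop)
    · exact (isClosed_le (by fun_prop) (by fun_prop)).inter (isClosed_le (by fun_prop) (by fun_prop))
  have clG : IsClosed (Gset m t) := by simpa [Gset] using cl 0
  have hAbd : ∀ q ∈ A, |q j| ≤ 1 + |s| := by
    rintro q ⟨-, h, -⟩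
    have := abs_add_le (q j - s) s
    simp only [sub_add_cancel] at this
    linarith
  have coA : IsCompact A := by
    refine (isCompact_closedBall (0 : Fin m → ℝ) (1 + |s|)).of_isClosed_subset clA ?_
    intro q hq
    rw [mem_closedBall_zero_iff, pi_norm_le_iff_of_nonneg (by positivity)]
    intro i
    rw [Real.norm_eq_abs]
    by_cases hi : i = j
    · subst hi; exact hAbd q hq
    · linarith [hq.1 i hi, abs_nonneg s]
  have coG : IsCompact (Gset m t) := by
    refine (isCompact_closedBall (0 : Fin m → ℝ) 1).of_isClosed_subset clG ?_
    intro q hq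
    rw [mem_closedBall_zero_iff, pi_norm_le_iff_of_nonneg (by positivity)]
    exact hq.1
  have hshift : omegaFn (m + 1) ξ t = ∫ q in A, |((m : ℝ) - (j : ℕ)) * ξ * t ^ m +
      ∑ i : Fin m, ((i : ℕ) + 1 : ℝ) * q i * t ^ (i : ℕ)| := by
    rw [hω, ← integral_indicator (cl _).measurableSet, ← integral_indicator clA.measurableSet,
      ← integral_sub_right_eq_self _ (Pi.single j s)]
    congr 1
    ext q
    have s1 : ∑ i : Fin m, (q - Pi.single j s : Fin m → ℝ) i * t ^ ((i : ℕ) + 1)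
        = ∑ i, q i * t ^ ((i : ℕ) + 1) - ξ * t ^ (m + 1) := by
      simp only [Pi.sub_apply, sub_mul, Finset.sum_sub_distrib]
      rw [← e1]
      congr 1
      simp [Pi.single_apply]
    have s2 : ∑ i : Fin m, ((i : ℕ) + 1 : ℝ) * (q - Pi.single j s : Fin m → ℝ) i * t ^ (i : ℕ)
        = ∑ i : Fin m, ((i : ℕ) + 1 : ℝ) * q i * t ^ (i : ℕ) - ((j : ℕ) + 1) * (ξ * t ^ m) := by
      simp only [Pi.sub_apply, sub_mul, mul_sub, Finset.sum_sub_distrib]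
      rw [← e2]
      congr 1
      simp [Pi.single_apply, mul_assoc]
    have hmem : (q - Pi.single j s ∈ {p : Fin m → ℝ | (∀ i, |p i| ≤ 1) ∧
      |ξ * t ^ (m + 1) + ∑ i, p i * t ^ ((i : ℕ) + 1)| ≤ 1}) ↔ q ∈ A := by
      simp only [Set.mem_ofPred_eq, s1, hAdef, add_sub_cancel]
      constructor
      · rintro ⟨h, h'⟩
        refine ⟨fun i hi => ?_, ?_, h'⟩
        · simpa [hi] using h i
        · simpa using h j
      · rintro ⟨h, h', h''⟩
        refine ⟨fun i => ?_, h''⟩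
        by_cases hi : i = j
        · subst hi; simpa using h'
        · simpa [hi] using h i hi
    by_cases hq : q ∈ A
    · rw [Set.indicator_of_mem hq, Set.indicator_of_mem (hmem.2 hq), s2]
      congr 1
      push_cast
      ring
    · rw [Set.indicator_of_notMem hq, Set.indicator_of_notMem (mt hmem.1 hq)]
  rw [hshift, phiFn]
  refine aux_int volume A (Gset m t) S _ _ _ M VA VS (by positivity) hM hVA hVS
    clA.measurableSet clG.measurableSet clS.measurableSet
    (ContinuousOn.integrableOn_compact coA (by fun_prop))
    (ContinuousOn.integrableOn_compact coG (by fun_prop)) ?_ ?_ ?_ ?_ h1 h2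
  · intro q
    refine (abs_abs_sub_abs_le _ _).trans ?_
    rw [add_sub_cancel_right, abs_mul, abs_mul, abs_pow, abs_of_pos hξ]
    have hj : ((j : ℕ) : ℝ) ≤ m := by exact_mod_cast hjm.le
    have : |(m : ℝ) - (j : ℕ)| ≤ m := by
      rw [abs_of_nonneg (by linarith)]
      linarith [Nat.cast_nonneg (α := ℝ) (j : ℕ)]
    gcongr
  · rintro q (hq | hq)
    · rw [abs_abs]; exact hgM q hq.1 (hAbd q hq) hq.2.2
    · rw [abs_abs]; exact hgM q (fun i _ => hq.1 i) (by linarith [hq.1 j, abs_nonneg s]) hq.2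
  · intro q hq hn
    refine ⟨hq.1, ?_, hq.2.2⟩
    have : 1 < |q j| := by
      by_contra h
      exact hn ⟨fun i => if hi : i = j then by subst hi; linarith else hq.1 i hi, hq.2.2⟩
    have := hAbd q hq
    rw [abs_le]; constructor <;> linarith [abs_nonneg s]
  · intro q hq hn
    refine ⟨fun i _ => hq.1 i, ?_, hq.2⟩
    have : 1 < |q j - s| := by
      by_contra h
      exact hn ⟨fun i _ => hq.1 i, by linarith, hq.2⟩
    have h3 := abs_sub (q j) s
    have := hq.1 j
    rw [abs_le]; constructor <;> linarith [abs_nonneg s]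

lemma aux_prod {m : ℕ} (j : Fin m) (x : ℝ) (hx : 0 ≤ x) :
    ∏ i, Function.update (fun _ : Fin m => (2 : ℝ)) j x i ≤ x * 2 ^ m := by
  rw [Finset.prod_update_of_mem (Finset.mem_univ j), Finset.prod_const]
  gcongr
  · norm_num
  · refine (Finset.card_le_univ _).trans (by simp)

lemma aux_small (m : ℕ) (hm : 2 ≤ m) (ξ t : ℝ) (hξ : 0 < ξ) (hξ1 : ξ < 1) (ht : |t| ≤ 1) :
    |omegaFn (m + 1) ξ t - phiFn m t| ≤ (m * 2 ^ m + 2 * m ^ 2 * (4 * 2 ^ m)) * ξ := by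
  set j : Fin m := ⟨0, by omega⟩ with hj
  have hs1 : |ξ * t ^ (m - (j : ℕ))| ≤ ξ := by
    rw [abs_mul, abs_pow, abs_of_pos hξ]
    exact mul_le_of_le_one_right hξ.le (pow_le_one₀ (abs_nonneg _) ht)
  have := aux_core m ξ t hξ j _ (2 * m ^ 2) (2 ^ m) (4 * ξ * 2 ^ m) rfl (by positivity)
    (by positivity) (by positivity) ?_ ?_ ?_
  · refine this.trans ?_
    have : |t| ^ m ≤ 1 := pow_le_one₀ (abs_nonneg _) ht
    have : (m : ℝ) * ξ * |t| ^ m * 2 ^ m ≤ m * ξ * 1 * 2 ^ m := by gcongr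
    linarith
  · intro q h1 h2 _
    refine (Finset.abs_sum_le_sum_abs _ _).trans ?_
    have : ∀ i ∈ (Finset.univ : Finset (Fin m)), |((i : ℕ) + 1 : ℝ) * q i * t ^ (i : ℕ)| ≤ 2 * (m : ℝ) := by
      intro i _
      have hi : ((i : ℕ) + 1 : ℝ) ≤ m := by exact_mod_cast i.2
      have hq : |q i| ≤ 2 := by
        by_cases h : i = j
        · subst h; linarith
        · linarith [h1 i h]
      have hp : |t| ^ (i : ℕ) ≤ 1 := pow_le_one₀ (abs_nonneg _) ht
      rw [abs_mul, abs_mul, abs_pow, abs_of_nonneg (by positivity : (0 : ℝ) ≤ (i : ℕ) + 1)]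
      calc _ ≤ (m : ℝ) * 2 * 1 := by gcongr
        _ = _ := by ring
    refine (Finset.sum_le_card_nsmul _ _ _ this).trans ?_
    simp
    apply le_of_eq; ring
  · have := aux_box (m := m) (Function.update (fun _ => {x : ℝ | |x| ≤ 1}) j
      {x : ℝ | |x - ξ * t ^ (m - (j : ℕ))| ≤ 1}) (fun _ => 2) (by intro i; norm_num) (by
        intro i
        by_cases h : i = j
        · subst h; rw [Function.update_self]; exact aux_unit_shift _
        · rw [Function.update_of_ne h]; exact aux_unit)
    refine (measure_mono ?_).trans (this.trans (by simp))
    rintro q ⟨h1, h2, -⟩ i -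
    by_cases h : i = j
    · subst h; rw [Function.update_self]; exact h2
    · rw [Function.update_of_ne h]; exact h1 i h
  · have := aux_box (m := m) (Function.update (fun _ => {x : ℝ | |x| ≤ 1}) j
      {x : ℝ | |(|x| - 1)| ≤ ξ}) (Function.update (fun _ => 2) j (4 * ξ)) (by
        intro i
        by_cases h : i = j
        · subst h; rw [Function.update_self]; positivity
        · rw [Function.update_of_ne h]; norm_num) (by
        intro i
        by_cases h : i = j
        · subst h; rw [Function.update_self, Function.update_self]; exact aux_ring _ hξ.le
        · rw [Function.update_of_ne h, Function.update_of_ne h]; exact aux_unit)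
    refine (measure_mono ?_).trans (this.trans (ENNReal.ofReal_le_ofReal
      (aux_prod j _ (by positivity))))
    rintro q ⟨h1, h2, -⟩ i -
    by_cases h : i = j
    · subst h; rw [Function.update_self]; exact le_trans h2 hs1
    · rw [Function.update_of_ne h]; exact h1 i h

lemma aux_large (k : ℕ) (ξ t : ℝ) (hξ : 0 < ξ) (ht : 1 ≤ |t|) :
    |omegaFn (k + 2 + 1) ξ t - phiFn (k + 2) t| ≤
      ((k + 2) * 2 ^ (k + 2) + (k + 2) * (k + 3) * (4 * 2 ^ (k + 2))) * ξ := by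
  have ht0 : 0 < |t| := by linarith
  have htne : t ≠ 0 := abs_pos.1 ht0
  set j : Fin (k + 2) := ⟨k + 1, by omega⟩ with hj
  set l : Fin (k + 2) := ⟨k, by omega⟩ with hl
  have hjl : j ≠ l := by simp [hj, hl]
  have hs1 : |ξ * t ^ (k + 2 - (j : ℕ))| = ξ * |t| := by
    have : k + 2 - (j : ℕ) = 1 := by simp only [hj]; omega
    rw [this, pow_one, abs_mul, abs_of_pos hξ]
  have := aux_core (k + 2) ξ t hξ j _ ((k + 2) * (k + 3) * |t| ^ k)
    ((|t| ^ (k + 2))⁻¹ * 2 ^ (k + 2)) ((|t| ^ (k + 1))⁻¹ * (4 * (ξ * |t|) * 2 ^ (k + 2)))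
    rfl (by positivity)
    (by positivity) (by positivity) ?_ ?_ ?_
  · refine this.trans (le_of_eq ?_)
    push_cast
    field_simp
    ring
  · intro q h1 _ h3
    have hid : t * ∑ i : Fin (k + 2), ((i : ℕ) + 1 : ℝ) * q i * t ^ (i : ℕ)
        = (k + 2) * ∑ i : Fin (k + 2), q i * t ^ ((i : ℕ) + 1)
          - ∑ i : Fin (k + 2), ((k : ℝ) + 1 - (i : ℕ)) * q i * t ^ ((i : ℕ) + 1) := by
      rw [Finset.mul_sum, Finset.mul_sum, ← Finset.sum_sub_distrib]
      refine Finset.sum_congr rfl fun i _ => ?_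
      ring
    have hb : ∀ i ∈ Finset.univ, |((k : ℝ) + 1 - ((i : Fin (k + 2)) : ℕ)) * q i * t ^ ((i : ℕ) + 1)|
        ≤ (k + 2) * |t| ^ (k + 1) := by
      intro i _
      by_cases h : i = j
      · subst h
        have : ((k : ℝ) + 1 - ((j : Fin (k + 2)) : ℕ)) = 0 := by simp [hj]
        rw [this]; simp; positivity
      · have hi : (i : ℕ) < k + 1 := by
          have := i.2
          have h' : (i : ℕ) ≠ k + 1 := fun h' => h (Fin.ext h')
          omega
        have hi' : ((i : ℕ) : ℝ) ≤ k + 1 := by exact_mod_cast hi.le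
        rw [abs_mul, abs_mul, abs_pow, abs_of_nonneg (by linarith)]
        have h4 : |t| ^ ((i : ℕ) + 1) ≤ |t| ^ (k + 1) := pow_le_pow_right₀ ht (by omega)
        calc _ ≤ ((k : ℝ) + 2) * 1 * |t| ^ (k + 1) := by
              gcongr
              · linarith [Nat.cast_nonneg (α := ℝ) (i : ℕ)]
              · exact h1 i h
          _ = _ := by ring
    have hsum : |∑ i : Fin (k + 2), ((k : ℝ) + 1 - (i : ℕ)) * q i * t ^ ((i : ℕ) + 1)|
        ≤ (k + 2) * ((k + 2) * |t| ^ (k + 1)) := by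
      refine (Finset.abs_sum_le_sum_abs _ _).trans
        ((Finset.sum_le_card_nsmul _ _ _ hb).trans (le_of_eq ?_))
      simp
    have h5 : |t| * |∑ i : Fin (k + 2), ((i : ℕ) + 1 : ℝ) * q i * t ^ (i : ℕ)|
        ≤ |t| * ((k + 2) * (k + 3) * |t| ^ k) := by
      rw [← abs_mul, hid]
      refine (abs_sub _ _).trans ?_
      rw [abs_mul, abs_of_nonneg (by positivity : (0 : ℝ) ≤ (k : ℝ) + 2)]
      have h6 : (1 : ℝ) ≤ |t| ^ (k + 1) := one_le_pow₀ ht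
      calc _ ≤ ((k : ℝ) + 2) * |t| ^ (k + 1) + (k + 2) * ((k + 2) * |t| ^ (k + 1)) := by
            gcongr
            linarith
        _ = _ := by ring
    exact le_of_mul_le_mul_left h5 ht0
  · have := aux_slab j (fun i => t ^ ((i : ℕ) + 1)) (pow_ne_zero _ htne)
      (fun _ => {x : ℝ | |x| ≤ 1}) (fun _ => 2) (by intro i; norm_num) (fun _ _ => aux_unit)
    refine (measure_mono ?_).trans (this.trans (ENNReal.ofReal_le_ofReal (le_of_eq ?_)))
    · rintro q ⟨h1, -, h3⟩
      exact ⟨h1, h3⟩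
    · simp [hj, abs_pow]
  · have := aux_slab l (fun i => t ^ ((i : ℕ) + 1)) (pow_ne_zero _ htne)
      (Function.update (fun _ => {x : ℝ | |x| ≤ 1}) j {x : ℝ | |(|x| - 1)| ≤ ξ * |t|})
      (Function.update (fun _ => 2) j (4 * (ξ * |t|))) (by
        intro i
        by_cases h : i = j
        · subst h; rw [Function.update_self]; positivity
        · rw [Function.update_of_ne h]; norm_num) (by
        intro i _
        by_cases h : i = j
        · subst h; rw [Function.update_self, Function.update_self]; exact aux_ring _ (by positivity)
        · rw [Function.update_of_ne h, Function.update_of_ne h]; exact aux_unit)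
    refine (measure_mono ?_).trans (this.trans (ENNReal.ofReal_le_ofReal ?_))
    · rintro q ⟨h1, h2, h3⟩
      refine ⟨fun i _ => ?_, h3⟩
      by_cases h : i = j
      · subst h; rw [Function.update_self]; exact le_trans h2 hs1.le
      · rw [Function.update_of_ne h]; exact h1 i h
    · have hu : Function.update (Function.update (fun _ : Fin (k + 2) => (2 : ℝ)) j (4 * (ξ * |t|))) l 2
          = Function.update (fun _ => 2) j (4 * (ξ * |t|)) := by
        rw [Function.update_eq_self_iff, Function.update_of_ne hjl.symm]
      rw [hu, abs_pow]
      exact mul_le_mul_of_nonneg_left (aux_prod j _ (by positivity)) (by positivity)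

theorem omega_phi_uniform (n : ℕ) (hn : 3 ≤ n) :
    (∃ C : ℝ, 0 < C ∧ ∀ ξ : ℝ, 0 < ξ → ξ < 1 → ∀ t : ℝ,
      |omegaFn n ξ t - phiFn (n - 1) t| ≤ C * ξ) ∧
    TendstoUniformly (fun ξ : ℝ => fun t : ℝ => omegaFn n ξ t) (phiFn (n - 1))
      (nhdsWithin 0 (Set.Ioi 0)) := by
  have main : ∃ C : ℝ, 0 < C ∧ ∀ ξ : ℝ, 0 < ξ → ξ < 1 → ∀ t : ℝ,
      |omegaFn n ξ t - phiFn (n - 1) t| ≤ C * ξ := by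
    obtain ⟨k, rfl⟩ : ∃ k, n = k + 2 + 1 := ⟨n - 3, by omega⟩
    refine ⟨(((k + 2 : ℕ) : ℝ) * 2 ^ (k + 2) + 2 * ((k + 2 : ℕ) : ℝ) ^ 2 * (4 * 2 ^ (k + 2))) +
      ((k + 2) * 2 ^ (k + 2) + (k + 2) * (k + 3) * (4 * 2 ^ (k + 2))), by positivity, ?_⟩
    intro ξ h0 h1 t
    rw [add_mul]
    rcases le_total |t| 1 with ht | ht
    · exact (aux_small (k + 2) (by omega) ξ t h0 h1 ht).trans
        (le_add_of_nonneg_right (by positivity))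
    · exact (aux_large k ξ t h0 ht).trans (le_add_of_nonneg_left (by positivity))
  refine ⟨main, ?_⟩
  obtain ⟨C, hC, h⟩ := main
  rw [Metric.tendstoUniformly_iff]
  intro ε hε
  have hpos : 0 < min 1 (ε / C) := lt_min one_pos (by positivity)
  filter_upwards [Ioo_mem_nhdsGT hpos] with ξ hξ t
  have h2 := h ξ hξ.1 (hξ.2.trans_le (min_le_left _ _)) t
  rw [dist_comm, Real.dist_eq]
  refine h2.trans_lt ?_
  have := hξ.2.trans_le (min_le_right _ _)
  rwa [lt_div_iff₀ hC, mul_comm] at this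
end

section
/- Fix an integer n ≥ 2 and set γ_{n−1} = ∫_ℝ φ_{n−1}(t) dt. Then 0 < γ_{n−1} < ∞, and lim_{ξ→0⁺} ∫_ℝ ω_n(ξ,t) dt = γ_{n−1} + 2^n; consequently lim_{ξ→0⁺} (∫_ℝ ω_n(ξ,t) dt)/(∫_ℝ φ_{n−1}(t) dt) = (γ_{n−1}+2^n)/γ_{n−1} > 1. -/
open MeasureTheory Filter

open Polynomial in
lemma io_bound (P : ℝ[X]) (n : ℕ) (hP : P.natDegree ≤ n) :
    ∫⁻ t in {t : ℝ | |P.eval t| ≤ 1}, ENNReal.ofReal |P.derivative.eval t| ≤ ENNReal.ofReal (2 * (n + 1)) := by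
  classical
  by_cases h0 : P.derivative = 0
  · simp [h0]
  set S : Finset ℝ := P.derivative.roots.toFinset with hS
  have hScard : S.card ≤ n := by
    calc S.card ≤ P.derivative.roots.card := Multiset.toFinset_card_le _
      _ ≤ P.derivative.natDegree := P.derivative.card_roots'
      _ ≤ P.natDegree - 1 := natDegree_derivative_le P
      _ ≤ n := by omega
  set c : ℝ → ℕ := fun x => (S.filter (· < x)).card with hc
  have hmono : Monotone c := by
    intro x y hxy
    apply Finset.card_le_card
    intro z hz
    simp only [Finset.mem_filter] at hz ⊢
    exact ⟨hz.1, hz.2.trans_le hxy⟩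
  have hcle : ∀ x, c x < n + 1 := fun x =>
    Nat.lt_succ_of_le ((Finset.card_filter_le _ _).trans hScard)
  set A : ℕ → Set ℝ := fun j => {x | c x = j} ∩ {t : ℝ | |P.eval t| ≤ 1} with hA
  have hmB : MeasurableSet {t : ℝ | |P.eval t| ≤ 1} :=
    (isClosed_le (by fun_prop) continuous_const).measurableSet
  have hmA : ∀ j, MeasurableSet (A j) := fun j =>
    (hmono.measurable (measurableSet_singleton j)).inter hmB
  have hcov : {t : ℝ | |P.eval t| ≤ 1} ⊆ ⋃ j ∈ Finset.range (n+1), A j := by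
    intro t ht
    simp only [Set.mem_iUnion, Finset.mem_range]
    exact ⟨c t, hcle t, rfl, ht⟩
  have hinj : ∀ j, Set.InjOn (fun x => P.eval x) (A j) := by
    intro j
    have key : ∀ x y, x ∈ A j → y ∈ A j → P.eval x = P.eval y → ¬ x < y := by
      intro x y hx hy hxy hlt
      obtain ⟨z, hz, hz'⟩ := exists_deriv_eq_zero (f := fun x => P.eval x) hlt
        P.continuous.continuousOn hxy
      rw [Polynomial.deriv] at hz'
      have hzS : z ∈ S := by
        rw [hS, Multiset.mem_toFinset, mem_roots h0]; exact hz'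
      have : c x < c y := by
        apply Finset.card_lt_card
        refine ⟨?_, fun h => ?_⟩
        · intro w hw
          simp only [Finset.mem_filter] at hw ⊢
          exact ⟨hw.1, hw.2.trans hlt⟩
        · have := h (Finset.mem_filter.2 ⟨hzS, hz.2⟩)
          simp only [Finset.mem_filter] at this
          exact absurd this.2 (not_lt.2 hz.1.le)
      have h1 : c x = j := hx.1
      have h2 : c y = j := hy.1
      omega
    intro x hx y hy hxy
    rcases lt_trichotomy x y with h | h | h
    · exact absurd h (key x y hx hy hxy)
    · exact h
    · exact absurd h (key y x hy hx hxy.symm)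
  have hone : ∀ j, ∫⁻ t in A j, ENNReal.ofReal |P.derivative.eval t| ≤ ENNReal.ofReal 2 := by
    intro j
    have := lintegral_image_eq_lintegral_abs_deriv_mul (hmA j)
      (fun x _ => (P.hasDerivAt x).hasDerivWithinAt) (hinj j) (fun _ => 1)
    simp only [mul_one, lintegral_const, one_mul, MeasurableSet.univ, Measure.restrict_apply,
      Set.univ_inter] at this
    rw [← this]
    calc volume ((fun x => P.eval x) '' A j) ≤ volume (Set.Icc (-1:ℝ) 1) := by
          apply measure_mono
          rintro _ ⟨x, hx, rfl⟩
          exact abs_le.1 hx.2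
      _ = ENNReal.ofReal 2 := by rw [Real.volume_Icc]; norm_num
  calc _ ≤ ∫⁻ t in ⋃ j ∈ Finset.range (n+1), A j, ENNReal.ofReal |P.derivative.eval t| :=
        lintegral_mono_set hcov
    _ ≤ ∑ j ∈ Finset.range (n+1), ∫⁻ t in A j, ENNReal.ofReal |P.derivative.eval t| := by
        have := lintegral_biUnion_finset (μ := volume) (s := Finset.range (n+1)) (t := A)
          (f := fun t => ENNReal.ofReal |P.derivative.eval t|) ?_ (fun j _ => hmA j)
        · exact this.le
        · intro i _ j _ hij
          rw [Function.onFun, Set.disjoint_left]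
          intro x hx hy
          exact hij (hx.1.symm.trans hy.1)
    _ ≤ ∑ j ∈ Finset.range (n+1), ENNReal.ofReal 2 := Finset.sum_le_sum fun j _ => hone j
    _ = ENNReal.ofReal (2 * (n + 1)) := by
        rw [Finset.sum_const, Finset.card_range, mul_comm (2:ℝ), ENNReal.ofReal_mul (by positivity)]
        rw [nsmul_eq_mul]; congr 1
        rw [ENNReal.ofReal_add (by positivity) (by norm_num)]; simp

open Polynomial in
noncomputable def ioV (P : ℝ[X]) : ℝ := ∫ t in {t : ℝ | |P.eval t| ≤ 1}, |P.derivative.eval t|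

open Polynomial in
lemma io_meas (P : ℝ[X]) : MeasurableSet {t : ℝ | |P.eval t| ≤ 1} :=
    (isClosed_le (by fun_prop) continuous_const).measurableSet

open Polynomial in
lemma io_int (P : ℝ[X]) : IntegrableOn (fun t => |P.derivative.eval t|) {t : ℝ | |P.eval t| ≤ 1} := by
  refine ⟨by fun_prop, ?_⟩
  rw [hasFiniteIntegral_iff_ofReal (ae_of_all _ fun _ => abs_nonneg _)]
  exact (io_bound P _ le_rfl).trans_lt ENNReal.ofReal_lt_top

open Polynomial in
lemma ioV_le (P : ℝ[X]) (n : ℕ) (hP : P.natDegree ≤ n) : ioV P ≤ 2 * (n + 1) := by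
  unfold ioV
  rw [integral_eq_lintegral_of_nonneg_ae (ae_of_all _ fun _ => abs_nonneg _) (by fun_prop)]
  exact ENNReal.toReal_le_of_le_ofReal (by positivity) (io_bound P n hP)

open Polynomial in
lemma io_flip (P : ℝ[X]) (m : ℕ) : ioV (C ((-1)^m) * P.comp (-X)) = ioV P := by
  have h1 : ((-1:ℝ))^m = 1 ∨ ((-1:ℝ))^m = -1 := neg_one_pow_eq_or ℝ m
  have h2 : |((-1:ℝ))^m| = 1 := by simp
  unfold ioV
  rw [← integral_indicator (io_meas _), ← integral_indicator (io_meas _)]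
  rw [← integral_neg_eq_self (fun t => Set.indicator {t : ℝ | |P.eval t| ≤ 1} _ t)]
  congr 1
  ext t
  simp only [Set.indicator, Set.mem_ofPred_eq, eval_mul, eval_C, eval_comp, eval_neg, eval_X, abs_mul,
    h2, one_mul, derivative_mul, derivative_C, derivative_comp, derivative_neg, derivative_X, zero_mul, zero_add]
  simp

open Polynomial in
lemma io_tail_bound (L : ℝ[X]) (m : ℕ) (hL : L.natDegree ≤ m) :
    ∃ K : ℝ, 0 ≤ K ∧ ∀ t : ℝ, 1 ≤ |t| → |L.eval t| ≤ K * |t| ^ m ∧ |t * L.derivative.eval t| ≤ K * |t| ^ m := by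
  have key : ∀ Q : ℝ[X], Q.natDegree ≤ m → ∀ t : ℝ, 1 ≤ |t| → |Q.eval t| ≤ (∑ i ∈ Finset.range (m+1), |Q.coeff i|) * |t|^m := by
    intro Q hQ t ht
    rw [eval_eq_sum_range' (Nat.lt_succ_of_le hQ), Finset.sum_mul]
    refine (Finset.abs_sum_le_sum_abs _ _).trans (Finset.sum_le_sum fun i hi => ?_)
    rw [abs_mul, abs_pow]
    have := Finset.mem_range.1 hi
    gcongr
    omega
  have hX : (X * L.derivative).natDegree ≤ m := by
    by_cases h : L.natDegree = 0
    · rw [derivative_of_natDegree_zero h]; simp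
    · have := natDegree_derivative_le L
      have h2 := natDegree_mul_le (p := X) (q := L.derivative)
      have h3 := natDegree_X_le (R := ℝ)
      omega
  refine ⟨(∑ i ∈ Finset.range (m+1), |L.coeff i|) + ∑ i ∈ Finset.range (m+1), |(X * L.derivative).coeff i|, by positivity, fun t ht => ⟨?_, ?_⟩⟩
  · refine (key L hL t ht).trans ?_
    gcongr
    have : 0 ≤ ∑ i ∈ Finset.range (m+1), |(X * L.derivative).coeff i| := by positivity
    linarith
  · have := key _ hX t ht
    rw [eval_mul, eval_X] at this
    refine this.trans ?_
    gcongr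
    have : 0 ≤ ∑ i ∈ Finset.range (m+1), |L.coeff i| := by positivity
    linarith

open Polynomial in
lemma io_lim_neg (m : ℕ) (L : ℝ[X]) (hL : L.natDegree ≤ m) (a : ℝ) (ha : a < 0) :
    Tendsto (fun ξ : ℝ => ioV (C ξ * X^(m+2) + C a * X^(m+1) + L)) (nhdsWithin 0 (Set.Ioi 0))
      (nhds (ioV (C 0 * X^(m+2) + C a * X^(m+1) + L) + 2)) := by
  obtain ⟨K, hK0, hK⟩ := io_tail_bound L m hL
  set P : ℝ → ℝ[X] := fun ξ => C ξ * X^(m+2) + C a * X^(m+1) + L with hP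
  have hev : ∀ ξ t, (P ξ).eval t = t ^ m * (t * (ξ * t + a)) + L.eval t := by
    intro ξ t; simp [hP]; ring
  have hdv0 : ∀ ξ t, (P ξ).derivative.eval t = (m+2) * ξ * t ^ (m+1) + (m+1) * a * t^m + L.derivative.eval t := by
    intro ξ t; simp [hP]; ring
  have hdv : ∀ ξ t, t * (P ξ).derivative.eval t = t ^ m * (t * ((m+2) * (ξ * t) + (m+1) * a)) + t * L.derivative.eval t := by
    intro ξ t; rw [hdv0]; ring
  obtain ⟨δ, hδ⟩ : ∃ δ : ℝ, δ = -a / (2 * (m+2)) := ⟨_, rfl⟩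
  have hδ0 : 0 < δ := by rw [hδ]; apply div_pos <;> [linarith; positivity]
  have hδa : a = - (2 * (m+2) * δ) := by rw [hδ]; field_simp
  have hm0 : (0:ℝ) ≤ m := Nat.cast_nonneg m
  obtain ⟨R, hR⟩ : ∃ R : ℝ, R = 1 + 2 * (K + 1) / δ := ⟨_, rfl⟩
  have hR1 : 1 ≤ R := by rw [hR]; have : 0 ≤ 2 * (K+1) / δ := by positivity
                         linarith
  have hRδ : 2 * (K + 1) ≤ R * δ := by
    rw [hR, add_mul, div_mul_cancel₀ _ hδ0.ne']; linarith
  have hmδ : 0 ≤ m * δ := by positivity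
  have hpow : ∀ t : ℝ, R ≤ |t| → 1 ≤ |t| ^ m := fun t ht => one_le_pow₀ (hR1.trans ht)
  -- left tail
  have h1 : ∀ ξ t : ℝ, 0 ≤ ξ → t < -R → 1 < |(P ξ).eval t| := by
    intro ξ t hξ ht
    have hat : |t| = -t := abs_of_neg (by linarith)
    have hRt : R ≤ |t| := by rw [hat]; linarith
    have hp := hpow t hRt
    have hL1 := (hK t (hR1.trans hRt)).1
    rw [hev]
    have e1 : |t ^ m * (t * (ξ * t + a))| = |t|^m * (|t| * |ξ * t + a|) := by
      rw [abs_mul, abs_mul, abs_pow]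
    have e2 : 2 * δ ≤ |ξ * t + a| := by
      rw [abs_of_nonpos (by nlinarith)]; nlinarith
    have e3 : K + 2 ≤ |t| * |ξ * t + a| := by
      calc K + 2 ≤ R * (2 * δ) := by linarith
        _ ≤ |t| * |ξ * t + a| := by gcongr
    have e4 : |t|^m * (K + 2) ≤ |t ^ m * (t * (ξ * t + a))| := by rw [e1]; gcongr
    have e5 := abs_sub_abs_le_abs_sub (t ^ m * (t * (ξ * t + a))) (-(L.eval t))
    rw [abs_neg, sub_neg_eq_add] at e5
    nlinarith
  have h2 : ∀ ξ t : ℝ, R ≤ t → ξ * t ≤ -a - δ → (P ξ).eval t < -1 := by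
    intro ξ t ht hξ
    have ht0 : 0 < t := by linarith
    have hat : |t| = t := abs_of_pos ht0
    have hp := hpow t (by rwa [hat])
    have hL1 := (hK t (by rw [hat]; linarith)).1
    rw [hat] at hp hL1
    rw [hev]
    have e3 : t * (ξ * t + a) ≤ -(K+2) := by
      have : R * δ ≤ t * δ := by gcongr
      nlinarith
    have e4 : t ^ m * (t * (ξ * t + a)) ≤ t^m * (-(K+2)) := by gcongr
    have := (abs_le.1 hL1).2
    nlinarith
  have h3 : ∀ ξ t : ℝ, R ≤ t → -a - δ ≤ ξ * t → 0 < (P ξ).derivative.eval t := by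
    intro ξ t ht hξ
    have ht0 : 0 < t := by linarith
    have hat : |t| = t := abs_of_pos ht0
    have hp := hpow t (by rwa [hat])
    have hL1 := (hK t (by rw [hat]; linarith)).2
    rw [hat] at hp hL1
    have e3 : K + 1 ≤ t * ((m+2) * (ξ * t) + (m+1) * a) := by
      have : R * δ ≤ t * δ := by gcongr
      have h5 : δ ≤ (m+2) * (ξ * t) + (m+1) * a := by
        have : (m+2) * (-a - δ) ≤ (m+2) * (ξ * t) := by gcongr
        nlinarith
      have : t * δ ≤ t * ((m+2) * (ξ * t) + (m+1) * a) := by gcongr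
      linarith
    have e4 : t^m * (K+1) ≤ t ^ m * (t * ((m+2) * (ξ * t) + (m+1) * a)) := by gcongr
    have := (abs_le.1 hL1).1
    have h6 : 0 < t * (P ξ).derivative.eval t := by rw [hdv]; nlinarith
    exact pos_of_mul_pos_right h6 ht0.le
  have h4 : ∀ ξ t : ℝ, R ≤ t → ξ * t = -a + δ → 1 ≤ (P ξ).eval t := by
    intro ξ t ht hξ
    have ht0 : 0 < t := by linarith
    have hat : |t| = t := abs_of_pos ht0
    have hp := hpow t (by rwa [hat])
    have hL1 := (hK t (by rw [hat]; linarith)).1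
    rw [hat] at hp hL1
    rw [hev]
    have e3 : (K+1) ≤ t * (ξ * t + a) := by
      have : R * δ ≤ t * δ := by gcongr
      have : ξ * t + a = δ := by linarith
      rw [this]; linarith
    have e4 : t^m * (K+1) ≤ t ^ m * (t * (ξ * t + a)) := by gcongr
    have := (abs_le.1 hL1).1
    nlinarith
  have haδ : 0 < -a - δ := by nlinarith
  -- the central part
  set J : ℝ → ℝ := fun ξ => ∫ t in Set.Icc (-R) R, Set.indicator {t : ℝ | |(P ξ).eval t| ≤ 1} (fun t => |(P ξ).derivative.eval t|) t with hJ
  have hJ' : ∀ ξ, J ξ = ∫ t in Set.Icc (-R) R ∩ {t : ℝ | |(P ξ).eval t| ≤ 1}, |(P ξ).derivative.eval t| := by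
    intro ξ
    rw [hJ]; simp only
    rw [setIntegral_indicator (io_meas _)]
  have hzero : ioV (P 0) = J 0 := by
    rw [hJ', ioV]
    congr 2
    apply Set.Subset.antisymm
    · intro t ht
      have ht' : |(P 0).eval t| ≤ 1 := ht
      refine ⟨⟨?_, ?_⟩, ht⟩
      · by_contra! h
        exact absurd (h1 0 t le_rfl h) (not_lt.2 ht')
      · by_contra! h
        have := h2 0 t h.le (by rw [zero_mul]; exact haδ.le)
        linarith [(abs_le.1 ht').1]
    · exact Set.inter_subset_right
  have hpos : ∀ ξ, 0 < ξ → ξ * R < -a - δ → ioV (P ξ) = J ξ + 2 := by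
    intro ξ hξ hξR
    set t0 := (-a - δ) / ξ with ht0
    set t1 := (-a + δ) / ξ with ht1
    have et0 : ξ * t0 = -a - δ := by rw [ht0]; field_simp
    have et1 : ξ * t1 = -a + δ := by rw [ht1]; field_simp
    have hRt0 : R < t0 := by rw [ht0, lt_div_iff₀ hξ]; linarith
    have ht01 : t0 ≤ t1 := by rw [ht0, ht1]; gcongr; linarith
    set T : Set ℝ := Set.Ici t0 ∩ {t : ℝ | |(P ξ).eval t| ≤ 1} with hT
    have hTm : MeasurableSet T := measurableSet_Ici.inter (io_meas _)
    have hsplit : {t : ℝ | |(P ξ).eval t| ≤ 1} = (Set.Icc (-R) R ∩ {t : ℝ | |(P ξ).eval t| ≤ 1}) ∪ T := by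
      apply Set.Subset.antisymm
      · intro t ht
        have ht' : |(P ξ).eval t| ≤ 1 := ht
        by_cases hh : t0 ≤ t
        · exact Or.inr ⟨hh, ht⟩
        · left
          refine ⟨⟨?_, ?_⟩, ht⟩
          · by_contra! h
            exact absurd (h1 ξ t hξ.le h) (not_lt.2 ht')
          · by_contra! h
            have := h2 ξ t h.le (by rw [← et0]; push Not at hh; gcongr)
            linarith [(abs_le.1 ht').1]
      · exact Set.union_subset Set.inter_subset_right Set.inter_subset_right
    have hdisj : Disjoint (Set.Icc (-R) R ∩ {t : ℝ | |(P ξ).eval t| ≤ 1}) T := by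
      rw [Set.disjoint_left]
      rintro x ⟨⟨_, hx⟩, _⟩ ⟨hx2, _⟩
      have : t0 ≤ x := hx2
      linarith
    have hstrict : StrictMonoOn (fun t => (P ξ).eval t) (Set.Ici t0) := by
      apply strictMonoOn_of_deriv_pos (convex_Ici _) (P ξ).continuous.continuousOn
      intro x hx
      rw [interior_Ici] at hx
      have hx : t0 < x := hx
      rw [Polynomial.deriv]
      exact h3 ξ x (by linarith) (by rw [← et0]; gcongr)
    have himg : (fun t => (P ξ).eval t) '' T = Set.Icc (-1) 1 := by
      apply Set.Subset.antisymm
      · rintro _ ⟨x, hx, rfl⟩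
        exact abs_le.1 hx.2
      · intro y hy
        have := intermediate_value_Icc ht01 (P ξ).continuous.continuousOn
        obtain ⟨x, hx, rfl⟩ := this ⟨(h2 ξ t0 hRt0.le et0.le).le.trans hy.1, hy.2.trans (h4 ξ t1 (by linarith) et1)⟩
        exact ⟨x, ⟨hx.1, abs_le.2 hy⟩, rfl⟩
    have hT2 : ∫ t in T, |(P ξ).derivative.eval t| = 2 := by
      have := integral_image_eq_integral_abs_deriv_smul hTm
        (fun x _ => ((P ξ).hasDerivAt x).hasDerivWithinAt) (hstrict.injOn.mono Set.inter_subset_left) (fun _ => (1:ℝ))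
      rw [himg] at this
      simp only [smul_eq_mul, mul_one] at this
      rw [← this]
      simp
      norm_num
    rw [ioV, hsplit, setIntegral_union hdisj hTm ((io_int _).mono_set Set.inter_subset_right)
      ((io_int _).mono_set Set.inter_subset_right), hT2, hJ']
  have hJlim : Tendsto J (nhdsWithin 0 (Set.Ioi 0)) (nhds (J 0)) := by
    apply tendsto_integral_filter_of_dominated_convergence
      (fun t => (m+2) * |t|^(m+1) + |(P 0).derivative.eval t|)
    · refine Eventually.of_forall fun ξ => ?_
      exact (Measurable.indicator (by fun_prop) (io_meas _)).aestronglyMeasurable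
    · have : ∀ᶠ ξ : ℝ in nhdsWithin 0 (Set.Ioi 0), ξ ∈ Set.Ioo (0:ℝ) 1 := Ioo_mem_nhdsGT (by norm_num)
      filter_upwards [this] with ξ hξ
      refine ae_of_all _ fun t => ?_
      refine (norm_indicator_le_norm_self _ _).trans ?_
      rw [Real.norm_eq_abs, abs_abs]
      have e : (P ξ).derivative.eval t = (m+2) * ξ * t^(m+1) + (P 0).derivative.eval t := by
        rw [hdv0, hdv0]; ring
      rw [e]
      refine (abs_add_le _ _).trans ?_
      gcongr
      rw [abs_mul, abs_mul, abs_pow, abs_of_pos hξ.1, abs_of_pos (by positivity : (0:ℝ) < m + 2)]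
      have := hξ.2.le
      have h0 : 0 ≤ |t|^(m+1) := by positivity
      nlinarith [mul_nonneg (mul_nonneg (by positivity : (0:ℝ) ≤ m+2) h0) (sub_nonneg.2 this)]
    · apply ContinuousOn.integrableOn_Icc
      apply Continuous.continuousOn
      fun_prop
    · have hfin : ∀ y : ℝ, {t : ℝ | (P 0).eval t = y}.Finite := by
        intro y
        have hne : P 0 - C y ≠ 0 := by
          intro h
          have hc : (P 0 - C y).coeff (m+1) = 0 := by rw [h]; simp
          have hLc : L.coeff (m+1) = 0 := coeff_eq_zero_of_natDegree_lt (by omega)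
          simp [hP, hLc, coeff_C, coeff_X_pow] at hc
          exact ha.ne hc
        refine ((P 0 - C y).roots.toFinset.finite_toSet).subset ?_
        intro t ht
        have ht : (P 0).eval t = y := ht
        simp [hne, mem_roots, ht, IsRoot]
      have hae : ∀ᵐ t : ℝ, |(P 0).eval t| ≠ 1 := by
        rw [ae_iff]
        refine Set.Finite.measure_zero (((hfin 1).union (hfin (-1))).subset ?_) _
        intro t ht
        have ht : ¬ (|(P 0).eval t| ≠ 1) := ht
        push Not at ht
        exact eq_or_eq_neg_of_abs_eq ht
      filter_upwards [ae_restrict_of_ae hae] with t ht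
      have hcont : ∀ t, Tendsto (fun ξ => |(P ξ).eval t|) (nhdsWithin 0 (Set.Ioi 0)) (nhds |(P 0).eval t|) := by
        intro t
        have : Continuous (fun ξ => |(P ξ).eval t|) := by simp only [hev]; fun_prop
        exact (this.tendsto 0).mono_left nhdsWithin_le_nhds
      have hcont' : Tendsto (fun ξ => |(P ξ).derivative.eval t|) (nhdsWithin 0 (Set.Ioi 0)) (nhds |(P 0).derivative.eval t|) := by
        have : Continuous (fun ξ => |(P ξ).derivative.eval t|) := by simp only [hdv0]; fun_prop
        exact (this.tendsto 0).mono_left nhdsWithin_le_nhds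
      rcases lt_or_gt_of_ne ht with h | h
      · have e0 : Set.indicator {t : ℝ | |(P 0).eval t| ≤ 1} (fun t => |(P 0).derivative.eval t|) t = |(P 0).derivative.eval t| :=
          Set.indicator_of_mem (show t ∈ {t : ℝ | |(P 0).eval t| ≤ 1} from h.le) _
        rw [e0]
        refine hcont'.congr' ?_
        filter_upwards [(hcont t).eventually_lt_const h] with ξ hξ
        exact (Set.indicator_of_mem (show t ∈ {t : ℝ | |(P ξ).eval t| ≤ 1} from hξ.le) (fun t => |(P ξ).derivative.eval t|)).symm
      · have e0 : Set.indicator {t : ℝ | |(P 0).eval t| ≤ 1} (fun t => |(P 0).derivative.eval t|) t = 0 :=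
          Set.indicator_of_notMem (show t ∉ {t : ℝ | |(P 0).eval t| ≤ 1} from not_le.2 h) _
        rw [e0]
        refine tendsto_const_nhds.congr' ?_
        filter_upwards [(hcont t).eventually_const_lt h] with ξ hξ
        exact (Set.indicator_of_notMem (show t ∉ {t : ℝ | |(P ξ).eval t| ≤ 1} from not_le.2 hξ) _).symm
  have hfinal : Tendsto (fun ξ => ioV (P ξ)) (nhdsWithin 0 (Set.Ioi 0)) (nhds (ioV (P 0) + 2)) := by
    rw [hzero]
    refine (hJlim.add_const 2).congr' ?_
    have : ∀ᶠ ξ : ℝ in nhdsWithin 0 (Set.Ioi 0), ξ ∈ Set.Ioo (0:ℝ) ((-a - δ) / R) :=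
      Ioo_mem_nhdsGT (div_pos haδ (by linarith))
    filter_upwards [this] with ξ hξ
    exact (hpos ξ hξ.1 ((lt_div_iff₀ (by linarith)).1 hξ.2)).symm
  exact hfinal

open Polynomial in
lemma io_lim (m : ℕ) (L : ℝ[X]) (hL : L.natDegree ≤ m) (a : ℝ) (ha : a ≠ 0) :
    Tendsto (fun ξ : ℝ => ioV (C ξ * X^(m+2) + C a * X^(m+1) + L)) (nhdsWithin 0 (Set.Ioi 0))
      (nhds (ioV (C 0 * X^(m+2) + C a * X^(m+1) + L) + 2)) := by
  rcases lt_or_gt_of_ne ha with h | h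
  · exact io_lim_neg m L hL a h
  have hL2 : (C ((-1)^m) * L.comp (-X)).natDegree ≤ m := by
    refine (natDegree_C_mul_le _ _).trans ?_
    refine natDegree_comp_le.trans ?_
    simpa using hL
  have key : ∀ ξ : ℝ, ioV (C ξ * X^(m+2) + C (-a) * X^(m+1) + C ((-1)^m) * L.comp (-X)) =
      ioV (C ξ * X^(m+2) + C a * X^(m+1) + L) := by
    intro ξ
    rw [← io_flip (C ξ * X^(m+2) + C a * X^(m+1) + L) m]
    congr 1
    have hs : ((-1 : ℝ[X]))^m * (-1)^m = 1 := by rw [← mul_pow]; simp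
    simp only [add_comp, mul_comp, C_comp, pow_comp, X_comp, map_neg, map_pow, map_one]
    rw [neg_pow (X : ℝ[X]) (m+2), neg_pow (X : ℝ[X]) (m+1)]
    linear_combination (-(C ξ * X^(m+2)) + C a * X^(m+1)) * hs
  have := io_lim_neg m _ hL2 (-a) (by linarith)
  simpa only [key] using this

open Polynomial in
noncomputable def ioQ (m : ℕ) (ξ : ℝ) (p : Fin (m+1) → ℝ) : ℝ[X] :=
  C ξ * X^(m+2) + ∑ i : Fin (m+1), C (p i) * X^((i:ℕ)+1)

lemma ioQ_eval (m : ℕ) (ξ t : ℝ) (p : Fin (m+1) → ℝ) :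
    (ioQ m ξ p).eval t = ξ * t^(m+2) + ∑ i : Fin (m+1), p i * t^((i:ℕ)+1) := by
  simp [ioQ, Polynomial.eval_finsetSum]

lemma ioQ_deriv (m : ℕ) (ξ t : ℝ) (p : Fin (m+1) → ℝ) :
    (ioQ m ξ p).derivative.eval t =
      ((m+2 : ℕ) : ℝ) * ξ * t^(m+1) + ∑ i : Fin (m+1), ((i:ℕ)+1 : ℝ) * p i * t^(i:ℕ) := by
  simp [ioQ, Polynomial.eval_finsetSum, Polynomial.derivative_sum]
  congr 1
  · ring
  · exact Finset.sum_congr rfl fun i _ => by ring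

open Polynomial in
lemma ioQ_natDegree (m : ℕ) (ξ : ℝ) (p : Fin (m+1) → ℝ) : (ioQ m ξ p).natDegree ≤ m + 2 := by
  unfold ioQ
  refine natDegree_add_le_of_degree_le (natDegree_C_mul_X_pow_le _ _) ?_
  refine natDegree_sum_le_of_forall_le _ _ fun i _ => ?_
  exact (natDegree_C_mul_X_pow_le _ _).trans (by omega)

def ioE (m : ℕ) (ξ : ℝ) : Set (ℝ × (Fin (m+1) → ℝ)) :=
  {x | (∀ i, |x.2 i| ≤ 1) ∧ |(ioQ m ξ x.2).eval x.1| ≤ 1}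

noncomputable def ioH (m : ℕ) (ξ : ℝ) : ℝ × (Fin (m+1) → ℝ) → ℝ :=
  (ioE m ξ).indicator (fun x => |(ioQ m ξ x.2).derivative.eval x.1|)

def ioBox (m : ℕ) : Set (Fin (m+1) → ℝ) := {p | ∀ i, |p i| ≤ 1}

lemma ioBox_eq (m : ℕ) : ioBox m = Set.pi Set.univ (fun _ => Set.Icc (-1:ℝ) 1) := by
  ext p
  rw [Set.mem_univ_pi]
  exact forall_congr' fun i => abs_le

lemma ioBox_meas (m : ℕ) : MeasurableSet (ioBox m) := by
  rw [ioBox_eq]; exact MeasurableSet.univ_pi fun _ => measurableSet_Icc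

lemma ioBox_vol (m : ℕ) : volume (ioBox m) = ENNReal.ofReal (2^(m+1)) := by
  rw [ioBox_eq, volume_pi_pi]
  simp [Real.volume_Icc]
  norm_num

lemma ioE_meas (m : ℕ) (ξ : ℝ) : MeasurableSet (ioE m ξ) := by
  apply IsClosed.measurableSet
  unfold ioE
  simp only [ioQ_eval]
  apply IsClosed.and
  · have : {x : ℝ × (Fin (m+1) → ℝ) | ∀ i, |x.2 i| ≤ 1} = ⋂ i, {x | |x.2 i| ≤ 1} := by ext; simp
    rw [this]
    exact isClosed_iInter fun i => isClosed_le (by fun_prop) continuous_const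
  · exact isClosed_le (by fun_prop) continuous_const

lemma ioH_meas (m : ℕ) (ξ : ℝ) : Measurable (ioH m ξ) := by
  apply Measurable.indicator _ (ioE_meas m ξ)
  simp only [ioQ_deriv]
  fun_prop

lemma ioH_nonneg (m : ℕ) (ξ : ℝ) (x) : 0 ≤ ioH m ξ x := Set.indicator_nonneg (fun _ _ => abs_nonneg _) _

lemma ioH_slice (m : ℕ) (ξ : ℝ) (p : Fin (m+1) → ℝ) (hp : p ∈ ioBox m) :
    (fun t => ioH m ξ (t, p)) =
      Set.indicator {t : ℝ | |(ioQ m ξ p).eval t| ≤ 1} (fun t => |(ioQ m ξ p).derivative.eval t|) := by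
  classical
  ext t
  have hp : ∀ i, |p i| ≤ 1 := hp
  simp [ioH, ioE, Set.indicator_apply, hp]

lemma ioH_slice' (m : ℕ) (ξ : ℝ) (p : Fin (m+1) → ℝ) (hp : p ∉ ioBox m) :
    (fun t => ioH m ξ (t, p)) = 0 := by
  ext t
  refine Set.indicator_of_notMem (fun h => hp h.1) _

lemma ioH_int_t (m : ℕ) (ξ : ℝ) (p : Fin (m+1) → ℝ) :
    ∫ t, ioH m ξ (t, p) = (ioBox m).indicator (fun p => ioV (ioQ m ξ p)) p := by
  by_cases hp : p ∈ ioBox m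
  · rw [ioH_slice m ξ p hp, Set.indicator_of_mem hp, integral_indicator (io_meas _), ioV]
  · rw [ioH_slice' m ξ p hp, Set.indicator_of_notMem hp]; simp

lemma ioH_omega (m : ℕ) (ξ t : ℝ) : omegaFn (m+2) ξ t = ∫ p, ioH m ξ (t, p) := by
  have hm : MeasurableSet {p | (t, p) ∈ ioE m ξ} := measurable_prodMk_left (ioE_meas m ξ)
  have h1 : (fun p => ioH m ξ (t, p)) = Set.indicator {p | (t, p) ∈ ioE m ξ}
      (fun p => |(ioQ m ξ p).derivative.eval t|) := by
    classical
    ext p; simp [ioH, Set.indicator_apply]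
  rw [h1, integral_indicator hm]
  simp only [ioE, ioQ_eval, ioQ_deriv]
  rfl

lemma ioH_integrable (m : ℕ) (ξ : ℝ) : Integrable (ioH m ξ) (volume.prod volume) := by
  refine ⟨(ioH_meas m ξ).aestronglyMeasurable, ?_⟩
  rw [hasFiniteIntegral_iff_ofReal (ae_of_all _ fun _ => ioH_nonneg m ξ _)]
  rw [lintegral_prod_symm _ (ioH_meas m ξ).ennreal_ofReal.aemeasurable]
  calc _ ≤ ∫⁻ p, (ioBox m).indicator (fun _ => ENNReal.ofReal (2 * ((m+2 : ℕ) + 1))) p := by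
        refine lintegral_mono fun p => ?_
        by_cases hp : p ∈ ioBox m
        · rw [Set.indicator_of_mem hp]
          refine le_trans (le_of_eq ?_) (io_bound _ _ (ioQ_natDegree m ξ p))
          rw [← lintegral_indicator (io_meas _)]
          refine lintegral_congr fun t => ?_
          have := congrFun (ioH_slice m ξ p hp) t
          rw [this]
          classical
          simp only [Set.indicator_apply]
          split_ifs <;> simp
        · have h0 : ∀ t, ioH m ξ (t, p) = 0 := fun t => congrFun (ioH_slice' m ξ p hp) t
          simp [h0]
    _ < ⊤ := by
        rw [lintegral_indicator_const (ioBox_meas m), ioBox_vol]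
        exact ENNReal.mul_lt_top ENNReal.ofReal_lt_top ENNReal.ofReal_lt_top

lemma io_omega_integrable (m : ℕ) (ξ : ℝ) : Integrable (omegaFn (m+2) ξ) := by
  have := (ioH_integrable m ξ).integral_prod_left
  refine this.congr (ae_of_all _ fun t => ?_)
  exact (ioH_omega m ξ t).symm

lemma io_omega_int (m : ℕ) (ξ : ℝ) : ∫ t, omegaFn (m+2) ξ t = ∫ p in ioBox m, ioV (ioQ m ξ p) := by
  simp only [ioH_omega]
  rw [integral_integral_swap (f := fun t p => ioH m ξ (t, p)) (ioH_integrable m ξ)]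
  simp only [ioH_int_t]
  rw [integral_indicator (ioBox_meas m)]

lemma io_pos (m : ℕ) : 0 < ∫ t, omegaFn (m+2) 0 t := by
  simp only [ioH_omega]
  rw [← integral_prod _ (ioH_integrable m 0),
    integral_pos_iff_support_of_nonneg (fun x => ioH_nonneg m 0 x) (ioH_integrable m 0)]
  set U : Set (ℝ × (Fin (m+1) → ℝ)) := {x | (∀ i, |x.2 i| < 1) ∧ |(ioQ m 0 x.2).eval x.1| < 1 ∧
    (ioQ m 0 x.2).derivative.eval x.1 ≠ 0} with hU
  have hUo : IsOpen U := by
    rw [hU]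
    simp only [ioQ_eval, ioQ_deriv]
    apply IsOpen.and
    · have : {x : ℝ × (Fin (m+1) → ℝ) | ∀ i, |x.2 i| < 1} = ⋂ i, {x | |x.2 i| < 1} := by ext; simp
      rw [this]
      exact isOpen_iInter_of_finite fun i => isOpen_lt (by fun_prop) continuous_const
    · apply IsOpen.and
      · exact isOpen_lt (by fun_prop) continuous_const
      · exact isOpen_ne_fun (by fun_prop) continuous_const
  have hne : U.Nonempty := by
    refine ⟨(0, fun _ => 1/2), ?_, ?_, ?_⟩
    · intro i; norm_num [abs_of_pos]
    · simp [ioQ_eval]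
    · simp [ioQ_deriv, Fin.sum_univ_succ]
  refine (hUo.measure_pos _ hne).trans_le (measure_mono ?_)
  rintro x ⟨hx1, hx2, hx3⟩
  rw [Function.mem_support, ioH, Set.indicator_of_mem]
  · exact abs_ne_zero.2 hx3
  · exact ⟨fun i => (hx1 i).le, hx2.le⟩

open Polynomial in
lemma io_Q_lim (m : ℕ) (p : Fin (m+1) → ℝ) (hp : p (Fin.last m) ≠ 0) :
    Tendsto (fun ξ => ioV (ioQ m ξ p)) (nhdsWithin 0 (Set.Ioi 0)) (nhds (ioV (ioQ m 0 p) + 2)) := by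
  set L : ℝ[X] := ∑ i : Fin m, C (p i.castSucc) * X^((i:ℕ)+1) with hL
  have hLd : L.natDegree ≤ m := by
    refine natDegree_sum_le_of_forall_le _ _ fun i _ => ?_
    exact (natDegree_C_mul_X_pow_le _ _).trans (by omega)
  have e : ∀ ξ, ioQ m ξ p = C ξ * X^(m+2) + C (p (Fin.last m)) * X^(m+1) + L := by
    intro ξ
    rw [ioQ, Fin.sum_univ_castSucc, hL]
    simp only [Fin.val_castSucc, Fin.val_last]
    ring
  simp only [e]
  exact io_lim m L hLd _ hp

lemma io_main (m : ℕ) : Tendsto (fun ξ : ℝ => ∫ t : ℝ, omegaFn (m+2) ξ t) (nhdsWithin 0 (Set.Ioi 0))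
      (nhds ((∫ t : ℝ, omegaFn (m+2) 0 t) + 2 ^ (m+2))) := by
  simp only [io_omega_int]
  have hfin : IsFiniteMeasure (volume.restrict (ioBox m)) := by
    refine ⟨?_⟩
    rw [Measure.restrict_apply_univ, ioBox_vol]; exact ENNReal.ofReal_lt_top
  have hmeas : ∀ ξ, AEStronglyMeasurable (fun p => ioV (ioQ m ξ p)) (volume.restrict (ioBox m)) := by
    intro ξ
    have h := (ioH_integrable m ξ).integral_prod_right.aestronglyMeasurable
    simp only [ioH_int_t] at h
    exact (aestronglyMeasurable_indicator_iff (ioBox_meas m)).1 h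
  have hnn : ∀ P, 0 ≤ ioV P := fun P => integral_nonneg fun _ => abs_nonneg _
  have hbd : ∀ ξ p, ‖ioV (ioQ m ξ p)‖ ≤ 2 * ((m+2 : ℕ) + 1) := fun ξ p => by
    rw [Real.norm_eq_abs, abs_of_nonneg (hnn _)]
    exact ioV_le _ _ (ioQ_natDegree m ξ p)
  have hae : ∀ᵐ p : Fin (m+1) → ℝ, p (Fin.last m) ≠ 0 := by
    exact (Measure.quasiMeasurePreserving_eval (fun _ : Fin (m+1) => (volume : Measure ℝ)) (Fin.last m)).ae
      (p := fun x => x ≠ 0) (Measure.ae_ne volume 0)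
  have hint : Integrable (fun p => ioV (ioQ m 0 p)) (volume.restrict (ioBox m)) :=
    (integrable_const (2 * (((m+2 : ℕ) : ℝ) + 1))).mono' (hmeas 0) (ae_of_all _ (hbd 0))
  have hE : (∫ p in ioBox m, ioV (ioQ m 0 p)) + 2^(m+2) = ∫ p in ioBox m, (ioV (ioQ m 0 p) + 2) := by
    rw [integral_add hint (integrable_const _)]
    congr 1
    rw [setIntegral_const, Measure.real, ioBox_vol, ENNReal.toReal_ofReal (by positivity), smul_eq_mul]
    ring
  rw [hE]
  apply tendsto_integral_filter_of_dominated_convergence (fun _ => 2 * (((m+2 : ℕ) : ℝ) + 1))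
  · exact Eventually.of_forall hmeas
  · exact Eventually.of_forall fun ξ => ae_of_all _ (hbd ξ)
  · exact integrable_const _
  · filter_upwards [ae_restrict_of_ae hae] with p hp
    exact io_Q_lim m p hp

lemma io_phi (m : ℕ) : phiFn (m+1) = omegaFn (m+2) 0 := by
  ext t
  simp [phiFn, omegaFn, Gset, Dset]

theorem integral_omega_limit (n : ℕ) (hn : 2 ≤ n) :
    0 < (∫ t : ℝ, phiFn (n - 1) t) ∧ Integrable (phiFn (n - 1)) ∧
    Tendsto (fun ξ : ℝ => ∫ t : ℝ, omegaFn n ξ t) (nhdsWithin 0 (Set.Ioi 0))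
      (nhds ((∫ t : ℝ, phiFn (n - 1) t) + 2 ^ n)) ∧
    Tendsto (fun ξ : ℝ => (∫ t : ℝ, omegaFn n ξ t) / (∫ t : ℝ, phiFn (n - 1) t))
      (nhdsWithin 0 (Set.Ioi 0))
      (nhds (((∫ t : ℝ, phiFn (n - 1) t) + 2 ^ n) / (∫ t : ℝ, phiFn (n - 1) t))) ∧
    1 < ((∫ t : ℝ, phiFn (n - 1) t) + 2 ^ n) / (∫ t : ℝ, phiFn (n - 1) t) := by
  obtain ⟨m, rfl⟩ : ∃ m, n = m + 2 := ⟨n - 2, by omega⟩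
  have e : phiFn (m + 2 - 1) = omegaFn (m+2) 0 := io_phi m
  have h0 := io_pos m
  have hl := io_main m
  rw [e]
  refine ⟨h0, io_omega_integrable m 0, hl, hl.div_const _, ?_⟩
  rw [one_lt_div h0]
  have : (0:ℝ) < 2^(m+2) := by positivity
  linarith
end
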